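/- arXiv:1602.03371 — 5 statements merged into one kernel-verified Lean document; each statement's English description precedes it below -/
import Mathlib

section
/- Fix θ > 0. There exists a constant S = S(θ) > 0, depending only on θ, with the following property: for every R₀ > 0, every pair of nondecreasing functions G, F : [R₀, +∞) → ℝ with F(R) > 0 and G(R) ≥ 0 for all R ≥ R₀ and G(R₀) > 0, and every pair of constants Λ ∈ (0,1) and B > 0 such that G(R) ≤ Λ^{B·R^θ/F(2R)} · G(2R) for each R ≥ R₀, one has, for each R ≥ 2R₀, (F(R)/R^θ)·log G(R) ≥ (F(R)/R^θ)·log G(R₀) + S·B·log(1/Λ). -/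
/-- **Iteration lemma** (Lemma 1.1 of Pigola–Rigoli–Setti).  Fix `θ > 0`.  There exists a
constant `S = S(θ) > 0`, depending only on `θ`, such that: for every `R₀ > 0`, every pair of
nondecreasing functions `G, F : [R₀, ∞) → ℝ` with `F > 0`, `G ≥ 0` on `[R₀, ∞)` and
`G R₀ > 0`, and every pair of constants `Λ ∈ (0,1)` and `B > 0` with
`G R ≤ Λ ^ (B * R ^ θ / F (2 * R)) * G (2 * R)` for each `R ≥ R₀`, one has, for each
`R ≥ 2 * R₀`,
`(F R / R ^ θ) * log (G R) ≥ (F R / R ^ θ) * log (G R₀) + S * B * log (1 / Λ)`. -/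
theorem iteration_lemma (θ : ℝ) (hθ : 0 < θ) :
    ∃ S : ℝ, 0 < S ∧
      ∀ (R₀ : ℝ), 0 < R₀ →
      ∀ (G F : ℝ → ℝ),
        MonotoneOn G (Set.Ici R₀) → MonotoneOn F (Set.Ici R₀) →
        (∀ R, R₀ ≤ R → 0 < F R) → (∀ R, R₀ ≤ R → 0 ≤ G R) → 0 < G R₀ →
      ∀ (Λ B : ℝ), 0 < Λ → Λ < 1 → 0 < B →
        (∀ R, R₀ ≤ R → G R ≤ Λ ^ (B * R ^ θ / F (2 * R)) * G (2 * R)) →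
      ∀ R, 2 * R₀ ≤ R →
        F R / R ^ θ * Real.log (G R₀) + S * B * Real.log (1 / Λ) ≤
          F R / R ^ θ * Real.log (G R) := by
  refine ⟨(1 / 2) ^ θ, by positivity, ?_⟩
  intro R₀ hR₀ G F hG _ hF _ hG₀ Λ B hΛ _ _ h R hR
  have hR₂ : R₀ ≤ R / 2 := by linarith
  have hRpos : 0 < R := by linarith
  have hFR : 0 < F R := hF R (by linarith)
  have hGmono : ∀ r, R₀ ≤ r → G R₀ ≤ G r := fun r hr => hG Set.self_mem_Ici hr hr
  have hGR : 0 < G R := hG₀.trans_le (hGmono R (by linarith))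
  have hstep : G R₀ ≤ Λ ^ (B * (R / 2) ^ θ / F R) * G R := by
    have := h (R / 2) hR₂
    rw [mul_div_cancel₀ R two_ne_zero] at this
    exact (hGmono _ hR₂).trans this
  have hlog := Real.log_le_log hG₀ hstep
  rw [Real.log_mul (Real.rpow_pos_of_pos hΛ _).ne' hGR.ne', Real.log_rpow hΛ] at hlog
  have hRθ : 0 < R ^ θ := Real.rpow_pos_of_pos hRpos θ
  have hhalf : (R / 2) ^ θ = R ^ θ * (1 / 2) ^ θ := by
    rw [← Real.mul_rpow hRpos.le (by norm_num), mul_one_div]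
  calc F R / R ^ θ * Real.log (G R₀) + (1 / 2) ^ θ * B * Real.log (1 / Λ)
      ≤ F R / R ^ θ * (B * (R / 2) ^ θ / F R * Real.log Λ + Real.log (G R))
          + (1 / 2) ^ θ * B * Real.log (1 / Λ) := by gcongr
    _ = F R / R ^ θ * Real.log (G R) := by
      rw [hhalf, one_div Λ, Real.log_inv]
      field_simp
      ring
end

section
/- Let m ≥ 2, ε > 0, w(x) = x_m − Σ_{i=1}^{m−1} x_i², Λ = {x ∈ ℝ^m : w(x) ≥ ε²}, and u(x) = ε − w(x)^{1/2}. Then for every γ < 0 and every x ∈ Λ with u(x) > γ one has Δu(x) ≥ (1 + 4(m−1)ε²)/(4(ε−γ)³) > 0; in particular the infimum of Δu over the superlevel set Ω_γ = {x ∈ Λ : u(x) > γ} is strictly positive for every γ < sup_Λ u = 0. -/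
/-- The partial derivative of `f : ℝ^m → ℝ` in the `i`-th coordinate direction. -/
noncomputable def pderivE {m : ℕ} (i : Fin m) (f : EuclideanSpace ℝ (Fin m) → ℝ)
    (x : EuclideanSpace ℝ (Fin m)) : ℝ :=
  fderiv ℝ f x (EuclideanSpace.single i 1)

/-- The Euclidean Laplacian of `f : ℝ^m → ℝ`, i.e. the sum of the pure second partial
derivatives. -/
noncomputable def laplacianE {m : ℕ} (f : EuclideanSpace ℝ (Fin m) → ℝ)
    (x : EuclideanSpace ℝ (Fin m)) : ℝ :=
  ∑ i, pderivE i (pderivE i f) x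

/-- Chain rule for the partial derivatives of `c - √w`. -/
lemma pderivE_const_sub_sqrt {m : ℕ} (i : Fin m) (c : ℝ) {w : EuclideanSpace ℝ (Fin m) → ℝ}
    {x : EuclideanSpace ℝ (Fin m)} (hw : DifferentiableAt ℝ w x) (hx : 0 < w x) :
    pderivE i (fun y => c - √(w y)) x = -pderivE i w x / (2 * √(w x)) := by
  have h := (hw.hasFDerivAt.sqrt hx.ne').const_sub c
  rw [pderivE, h.fderiv, pderivE]
  simp
  ring

open Filter Topology in
/-- The pure second partial derivatives of `c - √w`. -/
lemma pderivE_pderivE_const_sub_sqrt {m : ℕ} (i : Fin m) (c : ℝ)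
    {w : EuclideanSpace ℝ (Fin m) → ℝ} {x : EuclideanSpace ℝ (Fin m)}
    (hw : Differentiable ℝ w) (hw' : DifferentiableAt ℝ (pderivE i w) x) (hx : 0 < w x) :
    pderivE i (pderivE i (fun y => c - √(w y))) x =
      -pderivE i (pderivE i w) x / (2 * √(w x)) + pderivE i w x ^ 2 / (4 * √(w x) ^ 3) := by
  have hev : pderivE i (fun y => c - √(w y)) =ᶠ[𝓝 x]
      fun y => -(1 / 2) * (pderivE i w y * (√(w y))⁻¹) := by
    filter_upwards [hw.continuous.continuousAt.eventually (lt_mem_nhds hx)] with y hy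
    rw [pderivE_const_sub_sqrt i c hw.differentiableAt hy]
    field_simp
  have hs : √(w x) ≠ 0 := (Real.sqrt_pos.2 hx).ne'
  have hsqrt := hw.differentiableAt.hasFDerivAt.sqrt hx.ne'
  have hinv := (hasDerivAt_inv hs).comp_hasFDerivAt x hsqrt
  have h := (hw'.hasFDerivAt.mul hinv).const_mul (-(1 / 2))
  have h' : fderiv ℝ (fun y => -(1 / 2) * (pderivE i w y * (√(w y))⁻¹)) x = _ := h.fderiv
  rw [pderivE, hev.fderiv_eq, h']
  simp only [pderivE, Function.comp_apply, smul_apply,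
    add_apply, smul_eq_mul]
  field_simp
  ring

/-- The Laplacian of `c - √w`. -/
lemma laplacianE_const_sub_sqrt {m : ℕ} (c : ℝ) {w : EuclideanSpace ℝ (Fin m) → ℝ}
    {x : EuclideanSpace ℝ (Fin m)} (hw : Differentiable ℝ w)
    (hw' : ∀ i, DifferentiableAt ℝ (pderivE i w) x) (hx : 0 < w x) :
    laplacianE (fun y => c - √(w y)) x =
      -laplacianE w x / (2 * √(w x)) + (∑ i, pderivE i w x ^ 2) / (4 * √(w x) ^ 3) := by
  simp only [laplacianE, pderivE_pderivE_const_sub_sqrt _ c hw (hw' _) hx,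
    Finset.sum_add_distrib, Finset.sum_div, ← Finset.sum_neg_distrib]

/-- The quadratic function `x k - ∑ i ≠ k, x i ^ 2`, whose superlevel sets are the regions above
paraboloids. -/
noncomputable def paraboloidHeight {m : ℕ} (k : Fin m) (x : EuclideanSpace ℝ (Fin m)) : ℝ :=
  x k - ∑ i ∈ Finset.univ.erase k, x i ^ 2

lemma hasFDerivAt_paraboloidHeight {m : ℕ} (k : Fin m) (x : EuclideanSpace ℝ (Fin m)) :
    HasFDerivAt (paraboloidHeight k)
      (EuclideanSpace.proj k - ∑ i ∈ Finset.univ.erase k,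
        (2 * x i) • (EuclideanSpace.proj i : EuclideanSpace ℝ (Fin m) →L[ℝ] ℝ)) x := by
  have hp : ∀ i, HasFDerivAt (fun y : EuclideanSpace ℝ (Fin m) => y i)
      (EuclideanSpace.proj i : EuclideanSpace ℝ (Fin m) →L[ℝ] ℝ) x :=
    fun i => (EuclideanSpace.proj i : EuclideanSpace ℝ (Fin m) →L[ℝ] ℝ).hasFDerivAt
  refine (hp k).sub (HasFDerivAt.fun_sum fun i _ => ?_)
  simpa using (hp i).pow 2

lemma differentiable_paraboloidHeight {m : ℕ} (k : Fin m) :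
    Differentiable ℝ (paraboloidHeight k) :=
  fun x => (hasFDerivAt_paraboloidHeight k x).differentiableAt

lemma pderivE_paraboloidHeight_self {m : ℕ} (k : Fin m) :
    pderivE k (paraboloidHeight k) = fun _ => 1 := by
  ext x
  rw [pderivE, (hasFDerivAt_paraboloidHeight k x).fderiv]
  simp

lemma pderivE_paraboloidHeight_of_ne {m : ℕ} {i k : Fin m} (h : i ≠ k) :
    pderivE i (paraboloidHeight k) =
      ⇑((-2 : ℝ) • (EuclideanSpace.proj i : EuclideanSpace ℝ (Fin m) →L[ℝ] ℝ)) := by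
  ext x
  rw [pderivE, (hasFDerivAt_paraboloidHeight k x).fderiv]
  simp [h.symm]

lemma differentiable_pderivE_paraboloidHeight {m : ℕ} (i k : Fin m) :
    Differentiable ℝ (pderivE i (paraboloidHeight k)) := by
  rcases eq_or_ne i k with rfl | h
  · rw [pderivE_paraboloidHeight_self]
    exact differentiable_const _
  · rw [pderivE_paraboloidHeight_of_ne h]
    exact ContinuousLinearMap.differentiable _

lemma laplacianE_paraboloidHeight {m : ℕ} (k : Fin m) (x : EuclideanSpace ℝ (Fin m)) :
    laplacianE (paraboloidHeight k) x = -2 * ((m : ℝ) - 1) := by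
  have hk : pderivE k (pderivE k (paraboloidHeight k)) x = 0 := by
    simp [pderivE_paraboloidHeight_self, pderivE]
  have hi : ∀ i ∈ Finset.univ.erase k, pderivE i (pderivE i (paraboloidHeight k)) x = -2 := by
    intro i hi
    rw [pderivE_paraboloidHeight_of_ne (Finset.ne_of_mem_erase hi), pderivE,
      ContinuousLinearMap.fderiv]
    simp
  have hm : 1 ≤ m := k.pos
  rw [laplacianE, ← Finset.add_sum_erase _ _ (Finset.mem_univ k), hk, Finset.sum_congr rfl hi]
  simp [Nat.cast_sub hm]
  ring

lemma one_le_sum_pderivE_paraboloidHeight_sq {m : ℕ} (k : Fin m)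
    (x : EuclideanSpace ℝ (Fin m)) :
    1 ≤ ∑ i, pderivE i (paraboloidHeight k) x ^ 2 := by
  simpa [pderivE_paraboloidHeight_self] using Finset.single_le_sum
    (f := fun i => pderivE i (paraboloidHeight k) x ^ 2) (fun i _ => sq_nonneg _)
    (Finset.mem_univ k)

lemma le_laplacianE_const_sub_sqrt_paraboloidHeight {m : ℕ} (k : Fin m) {c ε r : ℝ} (hε : 0 < ε)
    {x : EuclideanSpace ℝ (Fin m)} (hx : ε ^ 2 ≤ paraboloidHeight k x)
    (hr : √(paraboloidHeight k x) ≤ r) :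
    (1 + 4 * ((m : ℝ) - 1) * ε ^ 2) / (4 * r ^ 3) ≤
      laplacianE (fun y => c - √(paraboloidHeight k y)) x := by
  have hpos : 0 < paraboloidHeight k x := (pow_pos hε 2).trans_le hx
  have hm : (0 : ℝ) ≤ (m : ℝ) - 1 := sub_nonneg.2 (mod_cast k.pos)
  have hsq := Real.sq_sqrt hpos.le
  rw [laplacianE_const_sub_sqrt c (differentiable_paraboloidHeight k)
    (fun i => (differentiable_pderivE_paraboloidHeight i k).differentiableAt) hpos,
    laplacianE_paraboloidHeight]
  have hs : 0 < √(paraboloidHeight k x) := Real.sqrt_pos.2 hpos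
  set s := √(paraboloidHeight k x)
  have hS := one_le_sum_pderivE_paraboloidHeight_sq k x
  set S := ∑ i, pderivE i (paraboloidHeight k) x ^ 2
  calc (1 + 4 * ((m : ℝ) - 1) * ε ^ 2) / (4 * r ^ 3)
      ≤ (S + 4 * ((m : ℝ) - 1) * s ^ 2) / (4 * s ^ 3) := by
        rw [← hsq] at hx
        gcongr
    _ = -(-2 * ((m : ℝ) - 1)) / (2 * s) + S / (4 * s ^ 3) := by
        field_simp
        ring

/-- Let `m ≥ 2`, `ε > 0`, `w x = x_m - ∑_{i=1}^{m-1} x_i ^ 2`, `Λ = {x ∈ ℝ^m : w x ≥ ε ^ 2}`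
and `u = ε - w ^ (1/2)`.  Then for every `γ < 0` and every `x ∈ Λ` with `u x > γ` one has
`Δu x ≥ (1 + 4 * (m - 1) * ε ^ 2) / (4 * (ε - γ) ^ 3) > 0`; in particular the infimum of `Δu`
over the superlevel set `Ω_γ = {x ∈ Λ : u x > γ}` is strictly positive for every
`γ < sup_Λ u = 0`. -/
theorem laplacian_inf_positive (m : ℕ) (hm : 2 ≤ m) (ε : ℝ) (hε : 0 < ε)
    (w u : EuclideanSpace ℝ (Fin m) → ℝ)
    (hw : ∀ x, w x = x ⟨m - 1, by omega⟩ -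
      ∑ i ∈ Finset.univ.erase (⟨m - 1, by omega⟩ : Fin m), (x i) ^ 2)
    (hu : ∀ x, u x = ε - Real.sqrt (w x)) :
    ∀ γ : ℝ, γ < 0 →
      (∀ x : EuclideanSpace ℝ (Fin m), ε ^ 2 ≤ w x → γ < u x →
        (1 + 4 * ((m : ℝ) - 1) * ε ^ 2) / (4 * (ε - γ) ^ 3) ≤ laplacianE u x) ∧
      0 < (1 + 4 * ((m : ℝ) - 1) * ε ^ 2) / (4 * (ε - γ) ^ 3) ∧
      0 < sInf {y : ℝ | ∃ x : EuclideanSpace ℝ (Fin m),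
        ε ^ 2 ≤ w x ∧ γ < u x ∧ y = laplacianE u x} := by
  intro γ hγ
  set k : Fin m := ⟨m - 1, by omega⟩
  obtain rfl : w = paraboloidHeight k := funext hw
  obtain rfl : u = fun x => ε - √(paraboloidHeight k x) := funext hu
  have hm' : (0 : ℝ) ≤ (m : ℝ) - 1 := sub_nonneg.2 (mod_cast k.pos)
  have hpos : 0 < (1 + 4 * ((m : ℝ) - 1) * ε ^ 2) / (4 * (ε - γ) ^ 3) := by
    have : 0 < ε - γ := by linarith
    positivity
  have hle : ∀ x : EuclideanSpace ℝ (Fin m), ε ^ 2 ≤ paraboloidHeight k x →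
      γ < ε - √(paraboloidHeight k x) → (1 + 4 * ((m : ℝ) - 1) * ε ^ 2) / (4 * (ε - γ) ^ 3) ≤
        laplacianE (fun x => ε - √(paraboloidHeight k x)) x := fun x hx hγx =>
    le_laplacianE_const_sub_sqrt_paraboloidHeight k hε hx (by linarith)
  refine ⟨hle, hpos, hpos.trans_le (le_csInf ?_ ?_)⟩
  · have hval : paraboloidHeight k (EuclideanSpace.single k (ε ^ 2)) = ε ^ 2 := by
      rw [paraboloidHeight, Finset.sum_eq_zero fun i hi => by
        simp [Finset.ne_of_mem_erase hi]]
      simp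
    exact ⟨_, EuclideanSpace.single k (ε ^ 2), hval.ge, by
      simpa [hval, Real.sqrt_sq hε.le] using hγ, rfl⟩
  · rintro _ ⟨x, hx, hγx, rfl⟩
    exact hle x hx hγx
end

section
/- Let m ≥ 2 and let H = {x ∈ ℝ^m : x_m ≥ 0} be the closed upper halfspace. Let T : ℝ^m → Sym_m(ℝ) be a C¹ field of symmetric positive definite m×m matrices, and suppose there are continuous functions T₋, T₊ : [0,∞) → (0,∞) with T₋(|x|)|X|² ≤ ⟨T(x)X, X⟩ ≤ T₊(|x|)|X|² for all x ∈ ℝ^m and X ∈ ℝ^m; set Θ(t) = max_{s∈[0,t]} T₊(s). Let Q : [0,∞) → (0,∞) be nondecreasing with Θ(t)Q(t) = o(t²) as t → +∞ and liminf_{t→+∞} Θ(t)Q(t)·log t / t² < +∞, and let q be a continuous function on H with 0 ≤ q(x) ≤ Q(|x|). Let u be C² on an open neighborhood of H with u* = sup_H u < +∞, and suppose that at every boundary point x (with x_m = 0) one has Σ_{j=1}^m T_{mj}(x) ∂_j u(x) ≥ 0, i.e. ⟨T(x)∇u(x), ν⟩ ≤ 0 where ν = −e_m is the outward unit normal to ∂H.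 Then for every γ < u*, inf { q(x)·div(T(x)∇u(x)) : x ∈ H, u(x) > γ } ≤ 0. -/
open Filter

open MeasureTheory

/-- The box `[-R, R]^(m-1) × [0, R]`, with the interval `[0, R]` in the `l`-th coordinate. -/
def halfBox {m : ℕ} (l : Fin m) (R : ℝ) : Set (Fin m → ℝ) :=
  Set.Icc (fun i => if i = l then 0 else -R) (fun _ => R)

lemma halfBox_nonneg {m : ℕ} {l : Fin m} {R : ℝ} {y : Fin m → ℝ} (hy : y ∈ halfBox l R) :
    0 ≤ y l := by
  simpa using hy.1 l

lemma isCompact_halfBox {m : ℕ} (l : Fin m) (R : ℝ) : IsCompact (halfBox l R) := isCompact_Icc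

lemma measurableSet_halfBox {m : ℕ} (l : Fin m) (R : ℝ) : MeasurableSet (halfBox l R) :=
  measurableSet_Icc

lemma volume_real_halfBox_le {m : ℕ} (l : Fin m) {R : ℝ} (hR : 0 < R) :
    volume.real (halfBox l R) ≤ (2 * R) ^ m := by
  have hle : (fun i => if i = l then 0 else -R) ≤ (fun _ : Fin m => R) := by
    intro i
    dsimp only
    split_ifs <;> linarith
  rw [Measure.real, halfBox, Real.volume_Icc_pi_toReal hle]
  calc ∏ i : Fin m, (R - if i = l then 0 else -R) ≤ ∏ _i : Fin m, (2 * R) := by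
        apply Finset.prod_le_prod
        · intro i _
          split_ifs <;> linarith
        · intro i _
          split_ifs <;> linarith
    _ = (2 * R) ^ m := by simp

lemma continuousAt_pderivE {m : ℕ} {f : EuclideanSpace ℝ (Fin m) → ℝ}
    {x : EuclideanSpace ℝ (Fin m)} (hf : ContDiffAt ℝ 1 f x) (i : Fin m) :
    ContinuousAt (pderivE i f) x :=
  ((hf.fderiv_right (m := 0) (by norm_num)).continuousAt).clm_apply continuousAt_const

lemma contDiffAt_pderivE {m : ℕ} {f : EuclideanSpace ℝ (Fin m) → ℝ}
    {x : EuclideanSpace ℝ (Fin m)} (hf : ContDiffAt ℝ 2 f x) (i : Fin m) :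
    ContDiffAt ℝ 1 (pderivE i f) x :=
  (hf.fderiv_right (m := 1) (by norm_num)).clm_apply contDiffAt_const

lemma integrableOn_halfBox {m : ℕ} {l : Fin m} {R : ℝ} {g : EuclideanSpace ℝ (Fin m) → ℝ}
    (hg : ∀ x : EuclideanSpace ℝ (Fin m), 0 ≤ x l → ContinuousAt g x) :
    IntegrableOn (fun y => g (WithLp.toLp 2 y)) (halfBox l R) := by
  refine ContinuousOn.integrableOn_compact (isCompact_halfBox l R) fun y hy => ?_
  refine ContinuousAt.continuousWithinAt ?_
  exact ContinuousAt.comp (f := fun y => WithLp.toLp 2 y) (hg _ (halfBox_nonneg hy))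
    (PiLp.continuous_toLp 2 _).continuousAt

/-- Divergence theorem on a halfspace for a compactly supported vector field that points inwards
along the boundary. -/
lemma integral_divergence_halfBox_nonpos {n : ℕ} (l : Fin (n + 1)) {R : ℝ} (hR : 0 < R)
    (F : Fin (n + 1) → EuclideanSpace ℝ (Fin (n + 1)) → ℝ)
    (hF : ∀ i, ∀ x : EuclideanSpace ℝ (Fin (n + 1)), 0 ≤ x l → ContDiffAt ℝ 1 (F i) x)
    (hsupp : ∀ i x, R ≤ ‖x‖ → F i x = 0)
    (hbd : ∀ x : EuclideanSpace ℝ (Fin (n + 1)), x l = 0 → 0 ≤ F l x) :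
    ∫ y in halfBox l R, ∑ i, pderivE i (F i) (WithLp.toLp 2 y) ≤ 0 := by
  set e : (Fin (n + 1) → ℝ) →L[ℝ] EuclideanSpace ℝ (Fin (n + 1)) :=
    ((EuclideanSpace.equiv (Fin (n + 1)) ℝ).symm :
      (Fin (n + 1) → ℝ) →L[ℝ] EuclideanSpace ℝ (Fin (n + 1))) with he
  have he_apply : ∀ y, e y = WithLp.toLp 2 y := fun y => rfl
  have hderiv : ∀ y ∈ halfBox l R, HasFDerivAt (fun z i => F i (WithLp.toLp 2 z))
      (ContinuousLinearMap.pi fun i => (fderiv ℝ (F i) (WithLp.toLp 2 y)).comp e) y := by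
    intro y hy
    rw [hasFDerivAt_pi]
    intro i
    have h1 := ((hF i (WithLp.toLp 2 y) (halfBox_nonneg hy)).differentiableAt
      (by norm_num)).hasFDerivAt
    exact HasFDerivAt.comp (f := fun z => e z) y h1 e.hasFDerivAt
  have hle : (fun i => if i = l then 0 else -R) ≤ (fun _ : Fin (n + 1) => R) := by
    intro i
    dsimp only
    split_ifs <;> linarith
  have hdiv : ∀ y, ∑ i, (ContinuousLinearMap.pi fun i =>
      (fderiv ℝ (F i) (WithLp.toLp 2 y)).comp e) (Pi.single i 1) i
      = ∑ i, pderivE i (F i) (WithLp.toLp 2 y) := by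
    intro y
    refine Finset.sum_congr rfl fun i _ => ?_
    simp [pderivE, he_apply, EuclideanSpace.single]
  have key := integral_divergence_of_hasFDerivAt_off_countable _ _ hle
    (fun z i => F i (WithLp.toLp 2 z))
    (fun y => ContinuousLinearMap.pi fun i => (fderiv ℝ (F i) (WithLp.toLp 2 y)).comp e)
    ∅ Set.countable_empty
    (fun y hy => (hderiv y hy).continuousAt.continuousWithinAt)
    (fun y hy => hderiv y
      ⟨fun i => (hy.1 i (Set.mem_univ i)).1.le, fun i => (hy.1 i (Set.mem_univ i)).2.le⟩)
    (by
      simp only [hdiv]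
      refine integrableOn_halfBox (l := l) (R := R)
        (g := fun x => ∑ i, pderivE i (F i) x) fun x hx => ?_
      exact tendsto_finsetSum _ fun i _ => continuousAt_pderivE (hF i x hx) i)
  simp only [hdiv] at key
  rw [halfBox, key]
  refine Finset.sum_nonpos fun i _ => ?_
  have hnorm : ∀ (c : ℝ) (y : Fin n → ℝ), |c| = R →
      F i (WithLp.toLp 2 (i.insertNth c y)) = 0 := by
    intro c y hc
    refine hsupp i _ ?_
    have h1 := PiLp.norm_apply_le (p := 2) (WithLp.toLp 2 (i.insertNth c y) :
      EuclideanSpace ℝ (Fin (n + 1))) i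
    simpa [hc] using h1
  have htop : ∀ y : Fin n → ℝ, F i (WithLp.toLp 2 (i.insertNth R y)) = 0 :=
    fun y => hnorm R y (abs_of_pos hR)
  simp only [htop, integral_zero, zero_sub, Left.neg_nonpos_iff]
  refine integral_nonneg fun y => ?_
  by_cases hi : i = l
  · subst hi
    simp only [if_true]
    exact hbd _ (by simp)
  · simp only [hi, if_false, Pi.zero_apply]
    exact (hnorm (-R) y (by rw [abs_neg, abs_of_pos hR])).ge

lemma hasDerivAt_max_zero_pow (p : ℕ) (t : ℝ) :
    HasDerivAt (fun t : ℝ => max t 0 ^ (p + 2)) ((p + 2) * max t 0 ^ (p + 1)) t := by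
  rcases lt_trichotomy t 0 with ht | rfl | ht
  · rw [max_eq_right ht.le]
    have h0 : HasDerivAt (fun _ : ℝ => (0 : ℝ)) 0 t := hasDerivAt_const t 0
    simp only [ne_eq, Nat.add_eq_zero_iff, one_ne_zero, and_false, not_false_eq_true, zero_pow,
      mul_zero]
    refine h0.congr_of_eventuallyEq ?_
    filter_upwards [gt_mem_nhds ht] with s hs
    rw [max_eq_right hs.le]
    simp
  · rw [hasDerivAt_iff_isLittleO_nhds_zero]
    simp only [zero_add, max_self, ne_eq, Nat.add_eq_zero_iff, one_ne_zero, and_false,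
      not_false_eq_true, zero_pow, mul_zero, smul_zero, sub_zero, OfNat.ofNat_ne_zero]
    have h1 : (fun h : ℝ => h ^ (p + 2)) =o[nhds 0] fun h : ℝ => h := by
      simpa using Asymptotics.isLittleO_pow_id (𝕜 := ℝ) (n := p + 2) (by omega)
    refine (Asymptotics.IsBigO.of_bound 1 (Filter.Eventually.of_forall fun h => ?_)).trans_isLittleO
      h1
    rw [one_mul, norm_pow, norm_pow]
    refine pow_le_pow_left₀ (norm_nonneg _) ?_ _
    rw [Real.norm_of_nonneg (le_max_right _ _)]
    exact max_le (le_abs_self h) (abs_nonneg h)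
  · rw [max_eq_left ht.le]
    have h0 := hasDerivAt_pow (p + 2) t
    simp only [Nat.add_succ_sub_one, Nat.cast_add, Nat.cast_ofNat] at h0
    refine h0.congr_of_eventuallyEq ?_
    filter_upwards [lt_mem_nhds ht] with s hs
    rw [max_eq_left hs.le]

lemma contDiff_max_zero_pow (p : ℕ) : ContDiff ℝ 1 (fun t : ℝ => max t 0 ^ (p + 2)) := by
  rw [contDiff_one_iff_deriv]
  refine ⟨fun t => (hasDerivAt_max_zero_pow p t).differentiableAt, ?_⟩
  rw [funext fun t => (hasDerivAt_max_zero_pow p t).deriv]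
  fun_prop

lemma pderivE_mul {m : ℕ} {f g : EuclideanSpace ℝ (Fin m) → ℝ} {x : EuclideanSpace ℝ (Fin m)}
    (hf : DifferentiableAt ℝ f x) (hg : DifferentiableAt ℝ g x) (i : Fin m) :
    pderivE i (fun z => f z * g z) x = pderivE i f x * g x + f x * pderivE i g x := by
  have h := (hf.hasFDerivAt.mul hg.hasFDerivAt).fderiv
  have h' : fderiv ℝ (fun z => f z * g z) x = f x • fderiv ℝ g x + g x • fderiv ℝ f x := h
  simp only [pderivE, h', add_apply, smul_apply, smul_eq_mul]
  ring

lemma pderivE_max_zero_pow {m : ℕ} {f : EuclideanSpace ℝ (Fin m) → ℝ}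
    {x : EuclideanSpace ℝ (Fin m)} (hf : DifferentiableAt ℝ f x) (p : ℕ) (i : Fin m) :
    pderivE i (fun z => max (f z) 0 ^ (p + 2)) x
      = (p + 2) * max (f x) 0 ^ (p + 1) * pderivE i f x := by
  have h : fderiv ℝ (fun z => max (f z) 0 ^ (p + 2)) x =
      ((p + 2) * max (f x) 0 ^ (p + 1)) • fderiv ℝ f x :=
    ((hasDerivAt_max_zero_pow p (f x)).comp_hasFDerivAt x hf.hasFDerivAt).fderiv
  simp only [pderivE, h, smul_apply, smul_eq_mul]

lemma pderivE_one_sub_normSq_div {m : ℕ} (R : ℝ) (x : EuclideanSpace ℝ (Fin m)) (i : Fin m) :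
    pderivE i (fun z => 1 - ‖z‖ ^ 2 / R ^ 2) x = -(2 / R ^ 2) * x i := by
  have h0 := (hasStrictFDerivAt_norm_sq x).hasFDerivAt
  have h : HasFDerivAt (fun z : EuclideanSpace ℝ (Fin m) => 1 - ‖z‖ ^ 2 / R ^ 2)
      (-((R ^ 2)⁻¹ • (2 • (innerSL ℝ) x))) x := by
    simpa [div_eq_mul_inv] using (h0.mul_const ((R ^ 2)⁻¹)).const_sub 1
  rw [pderivE, h.fderiv]
  simp [EuclideanSpace.inner_single_right]
  ring

lemma half_pow_sub_pow_le (s ε : ℝ) (κ : ℕ) :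
    (s ^ (2 * κ + 2) - ε ^ (2 * κ + 2)) / 2 ≤ s ^ (2 * κ + 2) - ε ^ 2 / 2 * s ^ (2 * κ) := by
  have h1 : s ^ (2 * κ + 2) = (s ^ 2) ^ κ * s ^ 2 := by ring
  have h2 : ε ^ (2 * κ + 2) = (ε ^ 2) ^ κ * ε ^ 2 := by ring
  have h3 : s ^ (2 * κ) = (s ^ 2) ^ κ := by ring
  rw [h1, h2, h3]
  rcases le_total (s ^ 2) (ε ^ 2) with h | h
  · have := pow_le_pow_left₀ (sq_nonneg s) h κ
    nlinarith [sq_nonneg ε, pow_nonneg (sq_nonneg s) κ, mul_nonneg (sub_nonneg.2 this) (sq_nonneg ε),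
      mul_nonneg (pow_nonneg (sq_nonneg s) κ) (sq_nonneg s)]
  · have := pow_nonneg (sq_nonneg s) κ
    have h4 := pow_nonneg (sq_nonneg ε) κ
    nlinarith [mul_nonneg this (sub_nonneg.2 h), mul_nonneg h4 (sq_nonneg ε)]

/-- The algebraic core of the Caccioppoli-type estimate: `s` is the cutoff, `w` the truncated
solution, and `a`, `b`, `d` are the entries of a nonnegative quadratic form. -/
lemma caccioppoli_pointwise {s w M B L a b d D ε : ℝ} {κ π : ℕ} (hκ : 1 ≤ κ)
    (hs : 0 ≤ s) (hw : 0 ≤ w) (hwM : w ≤ M) (hB : 0 ≤ B) (hd0 : 0 ≤ d)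
    (hquad : ∀ α β : ℝ, 0 ≤ α ^ 2 * a + 2 * α * β * b + β ^ 2 * d)
    (hd : 0 < s → d ≤ D) (hL : 0 < s → 0 < w → B ≤ L)
    (hε : ((κ : ℝ) + 1) ^ 2 * (M * D) / (π + 2) ≤ B * (ε ^ 2 / 2)) :
    B / 2 * (w ^ (π + 2) * (s ^ (2 * κ + 2) - ε ^ (2 * κ + 2))) ≤
      s ^ (2 * κ + 2) * w ^ (π + 2) * L
        + (((2 * κ : ℕ) : ℝ) + 2) * s ^ (2 * κ + 1) * w ^ (π + 2) * b
        + (π + 2) * s ^ (2 * κ + 2) * w ^ (π + 1) * a := by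
  rcases hw.eq_or_lt with rfl | hw'
  · simp
  rcases hs.eq_or_lt with rfl | hs'
  · have h1 : (0 : ℝ) ^ (2 * κ + 2) = 0 := by simp
    have h2 : (0 : ℝ) ^ (2 * κ + 1) = 0 := by simp
    rw [h1, h2]
    have h3 : (0 : ℝ) ≤ ε ^ (2 * κ + 2) := (show Even (2 * κ + 2) by grind).pow_nonneg ε
    have h4 : 0 ≤ B / 2 * (w ^ (π + 2) * ε ^ (2 * κ + 2)) := by positivity
    linarith
  have hp : (0 : ℝ) < π + 2 := by positivity
  have hq := mul_nonneg (show 0 ≤ ((π : ℝ) + 2) * s ^ (2 * κ) * w ^ (π + 1) by positivity)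
    (hquad s (((κ : ℝ) + 1) / (π + 2) * w))
  have hq' : ((π : ℝ) + 2) * s ^ (2 * κ) * w ^ (π + 1) *
      (s ^ 2 * a + 2 * s * (((κ : ℝ) + 1) / (π + 2) * w) * b
        + (((κ : ℝ) + 1) / (π + 2) * w) ^ 2 * d)
      = (((2 * κ : ℕ) : ℝ) + 2) * s ^ (2 * κ + 1) * w ^ (π + 2) * b
        + (π + 2) * s ^ (2 * κ + 2) * w ^ (π + 1) * a
        + s ^ (2 * κ) * w ^ (π + 2) * (((κ : ℝ) + 1) ^ 2 * (w * d) / (π + 2)) := by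
    push_cast
    field_simp
    ring
  have h1 : ((κ : ℝ) + 1) ^ 2 * (w * d) / (π + 2) ≤ B * (ε ^ 2 / 2) := by
    refine le_trans ?_ hε
    gcongr
    · exact hw.trans hwM
    · exact hd hs'
  have h2 : s ^ (2 * κ + 2) * w ^ (π + 2) * B ≤ s ^ (2 * κ + 2) * w ^ (π + 2) * L := by
    gcongr
    exact hL hs' hw'
  have h3 := mul_le_mul_of_nonneg_left h1 (show 0 ≤ s ^ (2 * κ) * w ^ (π + 2) by positivity)
  have h4 := mul_le_mul_of_nonneg_left (half_pow_sub_pow_le s ε κ)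
    (show 0 ≤ B * w ^ (π + 2) by positivity)
  rw [hq'] at hq
  linarith

/-- A differential inequality `div(T∇u) ≥ B` on `{u > γ} ∩ B_R` bounds weighted integrals of
powers of `(u - γ)₊` on the halfspace. -/
lemma integral_cutoff_mul_pow_le {n : ℕ} (l : Fin (n + 1))
    {T : EuclideanSpace ℝ (Fin (n + 1)) → Matrix (Fin (n + 1)) (Fin (n + 1)) ℝ}
    (hTsymm : ∀ x, (T x).IsSymm) (hTC1 : ∀ i j, ContDiff ℝ 1 (fun x => T x i j))
    (hT0 : ∀ x X : EuclideanSpace ℝ (Fin (n + 1)), 0 ≤ ∑ i, ∑ j, T x i j * X i * X j)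
    {R θ B M γ ε : ℝ} (hR : 0 < R) (hB : 0 < B) (hM : 0 ≤ M) (hε0 : 0 ≤ ε) (hθ : 0 ≤ θ)
    (hTR : ∀ x X : EuclideanSpace ℝ (Fin (n + 1)), ‖x‖ ≤ R →
      ∑ i, ∑ j, T x i j * X i * X j ≤ θ * ‖X‖ ^ 2)
    {u : EuclideanSpace ℝ (Fin (n + 1)) → ℝ}
    (hu : ∀ x : EuclideanSpace ℝ (Fin (n + 1)), 0 ≤ x l → ContDiffAt ℝ 2 u x)
    (huM : ∀ x : EuclideanSpace ℝ (Fin (n + 1)), 0 ≤ x l → u x - γ ≤ M)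
    (hbdy : ∀ x : EuclideanSpace ℝ (Fin (n + 1)), x l = 0 → 0 ≤ ∑ j, T x l j * pderivE j u x)
    (hL : ∀ x : EuclideanSpace ℝ (Fin (n + 1)), 0 ≤ x l → γ < u x → ‖x‖ ≤ R →
      B ≤ ∑ i, pderivE i (fun z => ∑ j, T z i j * pderivE j u z) x)
    {κ π : ℕ} (hκ : 1 ≤ κ)
    (hε : ((κ : ℝ) + 1) ^ 2 * (M * (4 * θ / R ^ 2)) / (π + 2) ≤ B * (ε ^ 2 / 2)) :
    ∫ y in halfBox l R, max (1 - ‖WithLp.toLp 2 y‖ ^ 2 / R ^ 2) 0 ^ (2 * κ + 2)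
        * max (u (WithLp.toLp 2 y) - γ) 0 ^ (π + 2)
      ≤ ε ^ (2 * κ + 2) * (M ^ (π + 2) * (2 * R) ^ (n + 1)) := by
  set φ : EuclideanSpace ℝ (Fin (n + 1)) → ℝ := fun z => 1 - ‖z‖ ^ 2 / R ^ 2 with hφ
  set V : Fin (n + 1) → EuclideanSpace ℝ (Fin (n + 1)) → ℝ :=
    fun i z => ∑ j, T z i j * pderivE j u z with hV
  set f1 : EuclideanSpace ℝ (Fin (n + 1)) → ℝ := fun z => max (φ z) 0 ^ (2 * κ + 2) with hf1
  set f2 : EuclideanSpace ℝ (Fin (n + 1)) → ℝ := fun z => max (u z - γ) 0 ^ (π + 2) with hf2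
  have hφC : ContDiff ℝ 1 φ := contDiff_const.sub ((contDiff_norm_sq ℝ).div_const _)
  have hVC : ∀ i, ∀ x : EuclideanSpace ℝ (Fin (n + 1)), 0 ≤ x l → ContDiffAt ℝ 1 (V i) x :=
    fun i x hx => ContDiffAt.sum fun j _ =>
      (hTC1 i j).contDiffAt.mul (contDiffAt_pderivE (hu x hx) j)
  have hf1C : ContDiff ℝ 1 f1 := (contDiff_max_zero_pow (2 * κ)).comp hφC
  have hu1 : ∀ x : EuclideanSpace ℝ (Fin (n + 1)), 0 ≤ x l →
      ContDiffAt ℝ 1 (fun z => u z - γ) x := fun x hx =>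
    ((hu x hx).of_le (by norm_num)).sub contDiffAt_const
  have hf2C : ∀ x : EuclideanSpace ℝ (Fin (n + 1)), 0 ≤ x l → ContDiffAt ℝ 1 f2 x :=
    fun x hx => ((contDiff_max_zero_pow π).contDiffAt).comp x (hu1 x hx)
  have hfC : ∀ x : EuclideanSpace ℝ (Fin (n + 1)), 0 ≤ x l →
      ContDiffAt ℝ 1 (fun z => f1 z * f2 z) x :=
    fun x hx => hf1C.contDiffAt.mul (hf2C x hx)
  have hFC : ∀ i, ∀ x : EuclideanSpace ℝ (Fin (n + 1)), 0 ≤ x l →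
      ContDiffAt ℝ 1 (fun z => f1 z * f2 z * V i z) x :=
    fun i x hx => (hfC x hx).mul (hVC i x hx)
  have hf1n : ∀ x, 0 ≤ f1 x := fun x => by positivity
  have hf2n : ∀ x, 0 ≤ f2 x := fun x => by positivity
  have hdiv := integral_divergence_halfBox_nonpos l hR (fun i z => f1 z * f2 z * V i z) hFC
    (by
      intro i x hx
      have h1 : φ x ≤ 0 := by
        have : R ^ 2 ≤ ‖x‖ ^ 2 := pow_le_pow_left₀ hR.le hx 2
        rw [hφ, sub_nonpos, one_le_div (by positivity)]
        exact this
      simp [hf1, max_eq_right h1])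
    (fun x hx => mul_nonneg (mul_nonneg (hf1n x) (hf2n x)) (hbdy x hx))
  have hpt : ∀ y ∈ halfBox l R, B / 2 * (f2 (WithLp.toLp 2 y) *
      (f1 (WithLp.toLp 2 y) - ε ^ (2 * κ + 2)))
      ≤ ∑ i, pderivE i (fun z => f1 z * f2 z * V i z) (WithLp.toLp 2 y) := by
    intro y hy
    set x : EuclideanSpace ℝ (Fin (n + 1)) := WithLp.toLp 2 y with hx
    have hxl : 0 ≤ x l := halfBox_nonneg hy
    have hd1 : ∀ i, pderivE i (fun z => u z - γ) x = pderivE i u x := fun i => by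
      simp [pderivE, fderiv_sub_const]
    have hf1d : ∀ i, pderivE i f1 x
        = (((2 * κ : ℕ) : ℝ) + 2) * max (φ x) 0 ^ (2 * κ + 1) * pderivE i φ x := fun i =>
      pderivE_max_zero_pow (hφC.differentiable (by norm_num) x) (2 * κ) i
    have hf2d : ∀ i, pderivE i f2 x
        = ((π : ℝ) + 2) * max (u x - γ) 0 ^ (π + 1) * pderivE i u x := fun i => by
      rw [← hd1 i]
      exact pderivE_max_zero_pow ((hu1 x hxl).differentiableAt (by norm_num)) π i
    have hFd : ∀ i, pderivE i (fun z => f1 z * f2 z * V i z) x =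
        (f1 x * f2 x * pderivE i (V i) x
          + (((2 * κ : ℕ) : ℝ) + 2) * max (φ x) 0 ^ (2 * κ + 1) * f2 x * (pderivE i φ x * V i x))
          + (π + 2) * f1 x * max (u x - γ) 0 ^ (π + 1) * (pderivE i u x * V i x) := by
      intro i
      rw [pderivE_mul ((hfC x hxl).differentiableAt (by norm_num))
        ((hVC i x hxl).differentiableAt (by norm_num)),
        pderivE_mul (hf1C.differentiable (by norm_num) x)
        ((hf2C x hxl).differentiableAt (by norm_num)), hf1d, hf2d]
      ring
    rw [Finset.sum_congr rfl fun i _ => hFd i, Finset.sum_add_distrib, Finset.sum_add_distrib,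
      ← Finset.mul_sum, ← Finset.mul_sum, ← Finset.mul_sum]
    have hexp : ∀ α β : ℝ, ∑ i, ∑ j, T x i j * (α * pderivE i u x + β * pderivE i φ x)
          * (α * pderivE j u x + β * pderivE j φ x)
        = α ^ 2 * (∑ i, pderivE i u x * V i x) + 2 * α * β * (∑ i, pderivE i φ x * V i x)
          + β ^ 2 * ∑ i, ∑ j, T x i j * pderivE i φ x * pderivE j φ x := by
      intro α β
      have hsym : ∑ i, ∑ j, T x i j * pderivE i u x * pderivE j φ x
          = ∑ i, ∑ j, T x i j * pderivE i φ x * pderivE j u x := by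
        rw [Finset.sum_comm]
        refine Finset.sum_congr rfl fun i _ => Finset.sum_congr rfl fun j _ => ?_
        rw [(hTsymm x).apply]
        ring
      have h2 : 2 * α * β * (∑ i, pderivE i φ x * V i x)
          = α * β * (∑ i, ∑ j, T x i j * pderivE i u x * pderivE j φ x)
            + α * β * (∑ i, ∑ j, T x i j * pderivE i φ x * pderivE j u x) := by
        have h3 : ∑ i, pderivE i φ x * V i x
            = ∑ i, ∑ j, T x i j * pderivE i φ x * pderivE j u x := by
          simp only [hV, Finset.mul_sum]
          refine Finset.sum_congr rfl fun i _ => Finset.sum_congr rfl fun j _ => ?_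
          ring
        rw [hsym, h3]
        ring
      rw [h2]
      simp only [hV, Finset.mul_sum, ← Finset.sum_add_distrib]
      refine Finset.sum_congr rfl fun i _ => Finset.sum_congr rfl fun j _ => ?_
      ring
    have hquad : ∀ α β : ℝ, 0 ≤ α ^ 2 * (∑ i, pderivE i u x * V i x)
        + 2 * α * β * (∑ i, pderivE i φ x * V i x)
        + β ^ 2 * ∑ i, ∑ j, T x i j * pderivE i φ x * pderivE j φ x := by
      intro α β
      rw [← hexp]
      exact hT0 x (WithLp.toLp 2 fun i => α * pderivE i u x + β * pderivE i φ x)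
    have hxR : 0 < max (φ x) 0 → ‖x‖ ≤ R := by
      intro h
      by_contra! hlt
      have h1 : R ^ 2 ≤ ‖x‖ ^ 2 := pow_le_pow_left₀ hR.le hlt.le 2
      have h2 : φ x ≤ 0 := by
        rw [hφ, sub_nonpos, one_le_div (by positivity)]
        exact h1
      rw [max_eq_right h2] at h
      exact lt_irrefl _ h
    refine caccioppoli_pointwise hκ (le_max_right _ _) (le_max_right _ _)
      (max_le (huM x hxl) hM) hB.le (by simpa using hquad 0 1) hquad ?_ ?_ hε
    · intro hs
      have hn := hxR hs
      have h1 : ∑ i, ∑ j, T x i j * pderivE i φ x * pderivE j φ x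
          = (2 / R ^ 2) ^ 2 * ∑ i, ∑ j, T x i j * x i * x j := by
        simp only [hφ, pderivE_one_sub_normSq_div, Finset.mul_sum]
        refine Finset.sum_congr rfl fun i _ => Finset.sum_congr rfl fun j _ => ?_
        ring
      rw [h1]
      calc (2 / R ^ 2) ^ 2 * ∑ i, ∑ j, T x i j * x i * x j
          ≤ (2 / R ^ 2) ^ 2 * (θ * R ^ 2) := by
            gcongr
            refine (hTR x x hn).trans ?_
            gcongr
        _ = 4 * θ / R ^ 2 := by
            field_simp
            ring
    · intro hs hw
      refine hL x hxl ?_ (hxR hs)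
      by_contra! h
      rw [max_eq_right (by linarith)] at hw
      exact lt_irrefl _ hw
  have hf2I : IntegrableOn (fun y => f2 (WithLp.toLp 2 y)) (halfBox l R) :=
    integrableOn_halfBox fun x hx => (hf2C x hx).continuousAt
  have hfI : IntegrableOn (fun y => f1 (WithLp.toLp 2 y) * f2 (WithLp.toLp 2 y)) (halfBox l R) :=
    integrableOn_halfBox (g := fun x => f1 x * f2 x) fun x hx => (hfC x hx).continuousAt
  have hdI : IntegrableOn
      (fun y => ∑ i, pderivE i (fun z => f1 z * f2 z * V i z) (WithLp.toLp 2 y)) (halfBox l R) :=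
    integrableOn_halfBox (g := fun x => ∑ i, pderivE i (fun z => f1 z * f2 z * V i z) x)
      fun x hx => tendsto_finsetSum _ fun i _ => continuousAt_pderivE (hFC i x hx) i
  have hlow : (fun y => B / 2 * (f2 (WithLp.toLp 2 y) *
      (f1 (WithLp.toLp 2 y) - ε ^ (2 * κ + 2)))) = fun y => B / 2 *
      (f1 (WithLp.toLp 2 y) * f2 (WithLp.toLp 2 y) - ε ^ (2 * κ + 2) * f2 (WithLp.toLp 2 y)) := by
    funext y
    ring
  have hmono := setIntegral_mono_on (by
      rw [hlow]
      exact (hfI.sub (hf2I.const_mul _)).const_mul _) hdI (measurableSet_halfBox l R) hpt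
  rw [hlow, integral_const_mul, integral_sub hfI (hf2I.const_mul _), integral_const_mul] at hmono
  have h1 : ∫ y in halfBox l R, f1 (WithLp.toLp 2 y) * f2 (WithLp.toLp 2 y)
      ≤ ε ^ (2 * κ + 2) * ∫ y in halfBox l R, f2 (WithLp.toLp 2 y) := by
    have := hmono.trans hdiv
    nlinarith
  refine h1.trans ?_
  gcongr
  have hconst : IntegrableOn (fun _ : Fin (n + 1) → ℝ => M ^ (π + 2)) (halfBox l R) :=
    integrableOn_const (isCompact_halfBox l R).measure_lt_top.ne
  calc ∫ y in halfBox l R, f2 (WithLp.toLp 2 y) ≤ ∫ y in halfBox l R, M ^ (π + 2) := by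
        refine setIntegral_mono_on hf2I hconst (measurableSet_halfBox l R) fun y hy => ?_
        exact pow_le_pow_left₀ (le_max_right _ _) (max_le (huM _ (halfBox_nonneg hy)) hM) _
    _ = volume.real (halfBox l R) * M ^ (π + 2) := by
        rw [setIntegral_const, smul_eq_mul]
    _ ≤ M ^ (π + 2) * (2 * R) ^ (n + 1) := by
        rw [mul_comm]
        gcongr
        exact volume_real_halfBox_le l hR

/-- A halfspace point where `u` exceeds a level can be moved inside the halfspace and thickened
to a ball. -/
lemma exists_ball_subset_superlevel {m : ℕ} (l : Fin m) {u : EuclideanSpace ℝ (Fin m) → ℝ}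
    (hu : ∀ x : EuclideanSpace ℝ (Fin m), 0 ≤ x l → ContinuousAt u x) {a : ℝ}
    {x₀ : EuclideanSpace ℝ (Fin m)} (hx₀ : 0 ≤ x₀ l) (hux₀ : a < u x₀) :
    ∃ (y₁ : Fin m → ℝ) (r R₀ : ℝ), 0 < r ∧ ∀ y ∈ Metric.ball y₁ r,
      0 < y l ∧ a < u (WithLp.toLp 2 y) ∧ ‖(WithLp.toLp 2 y : EuclideanSpace ℝ (Fin m))‖ < R₀ := by
  have hpath : Tendsto (fun t : ℝ => x₀ + t • EuclideanSpace.single l (1 : ℝ)) (nhds 0)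
      (nhds x₀) := by
    have : Continuous fun t : ℝ => x₀ + t • EuclideanSpace.single l (1 : ℝ) := by fun_prop
    simpa using this.tendsto 0
  have hev : ∀ᶠ t in nhdsWithin (0 : ℝ) (Set.Ioi 0),
      a < u (x₀ + t • EuclideanSpace.single l (1 : ℝ)) :=
    nhdsWithin_le_nhds (((hu x₀ hx₀).tendsto.comp hpath).eventually (lt_mem_nhds hux₀))
  obtain ⟨t, ht, ht0⟩ := (hev.and self_mem_nhdsWithin).exists
  set x₁ := x₀ + t • EuclideanSpace.single l (1 : ℝ) with hx₁
  have hx₁l : 0 < x₁ l := by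
    have : x₁ l = x₀ l + t := by simp [hx₁]
    rw [this]
    exact add_pos_of_nonneg_of_pos hx₀ ht0
  have htoLp : Tendsto (fun y : Fin m → ℝ => (WithLp.toLp 2 y : EuclideanSpace ℝ (Fin m)))
      (nhds (WithLp.ofLp x₁)) (nhds x₁) :=
    (PiLp.continuous_toLp 2 _).tendsto (WithLp.ofLp x₁)
  have h1 := htoLp.eventually ((hu x₁ hx₁l.le).tendsto.eventually (lt_mem_nhds ht))
  have h2 := htoLp.eventually
    (continuous_norm.continuousAt.tendsto.eventually (gt_mem_nhds (lt_add_one ‖x₁‖)))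
  have h3 : ∀ᶠ y : Fin m → ℝ in nhds (WithLp.ofLp x₁), 0 < y l :=
    (continuous_apply l).continuousAt.tendsto.eventually (lt_mem_nhds hx₁l)
  obtain ⟨r, hr, hball⟩ := Metric.eventually_nhds_iff_ball.1 (h3.and (h1.and h2))
  exact ⟨WithLp.ofLp x₁, r, ‖x₁‖ + 1, hr, hball⟩

lemma volume_ball_mul_le_integral_cutoff {n : ℕ} (l : Fin (n + 1))
    {u : EuclideanSpace ℝ (Fin (n + 1)) → ℝ}
    (hu : ∀ x : EuclideanSpace ℝ (Fin (n + 1)), 0 ≤ x l → ContinuousAt u x)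
    {γ b R₀ R r : ℝ} (hb : 0 ≤ b) (hR : 0 < R) (hRR : 2 * R₀ ≤ R) {y₁ : Fin (n + 1) → ℝ}
    (hball : ∀ y ∈ Metric.ball y₁ r, 0 < y l ∧ γ + b < u (WithLp.toLp 2 y) ∧
      ‖(WithLp.toLp 2 y : EuclideanSpace ℝ (Fin (n + 1)))‖ < R₀) (j p : ℕ) :
    volume.real (Metric.ball y₁ r) * ((3 / 4) ^ j * b ^ p) ≤
      ∫ y in halfBox l R, max (1 - ‖WithLp.toLp 2 y‖ ^ 2 / R ^ 2) 0 ^ j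
        * max (u (WithLp.toLp 2 y) - γ) 0 ^ p := by
  have hsub : Metric.ball y₁ r ⊆ halfBox l R := by
    intro y hy
    obtain ⟨h1, -, h3⟩ := hball y hy
    have hyR : ∀ i, |y i| ≤ R := fun i => by
      have h4 := PiLp.norm_apply_le (p := 2)
        (WithLp.toLp 2 y : EuclideanSpace ℝ (Fin (n + 1))) i
      have h5 := norm_nonneg (WithLp.toLp 2 y : EuclideanSpace ℝ (Fin (n + 1)))
      rw [Real.norm_eq_abs] at h4
      exact h4.trans (by linarith)
    refine ⟨fun i => ?_, fun i => (abs_le.1 (hyR i)).2⟩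
    dsimp only
    split_ifs with hi
    · rw [hi]
      exact h1.le
    · exact (abs_le.1 (hyR i)).1
  have hI : IntegrableOn (fun y => max (1 - ‖WithLp.toLp 2 y‖ ^ 2 / R ^ 2) 0 ^ j
      * max (u (WithLp.toLp 2 y) - γ) 0 ^ p) (halfBox l R) := by
    refine integrableOn_halfBox (g := fun x => max (1 - ‖x‖ ^ 2 / R ^ 2) 0 ^ j
      * max (u x - γ) 0 ^ p) fun x hx => ?_
    have := hu x hx
    fun_prop
  have hconst : IntegrableOn (fun _ : Fin (n + 1) → ℝ => (3 / 4 : ℝ) ^ j * b ^ p)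
      (Metric.ball y₁ r) := integrableOn_const measure_ball_lt_top.ne
  rw [← smul_eq_mul, ← setIntegral_const]
  refine (setIntegral_mono_on hconst (hI.mono_set hsub) measurableSet_ball fun y hy => ?_).trans
    (setIntegral_mono_set hI (Eventually.of_forall fun y => ?_) hsub.eventuallyLE)
  · obtain ⟨-, h2, h3⟩ := hball y hy
    have h4 : (2 * ‖(WithLp.toLp 2 y : EuclideanSpace ℝ (Fin (n + 1)))‖) ^ 2 ≤ R ^ 2 :=
      pow_le_pow_left₀ (by positivity) (by linarith) 2
    have h5 : ‖(WithLp.toLp 2 y : EuclideanSpace ℝ (Fin (n + 1)))‖ ^ 2 / R ^ 2 ≤ 1 / 4 := by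
      rw [div_le_iff₀ (by positivity)]
      linarith
    gcongr
    · exact le_max_of_le_left (by linarith)
    · exact le_max_of_le_left (by linarith)
  · simp only [Pi.zero_apply]
    positivity

lemma tendsto_two_thirds_pow_ceil_log :
    Tendsto (fun R : ℝ => (2 / 3 : ℝ) ^ ⌈Real.log R⌉₊) atTop (nhds 0) :=
  (tendsto_pow_atTop_nhds_zero_of_lt_one (by norm_num) (by norm_num)).comp
    (tendsto_nat_ceil_atTop.comp Real.tendsto_log_atTop)

lemma le_three_pow_ceil_log {R : ℝ} (hR : 0 < R) : R ≤ 3 ^ ⌈Real.log R⌉₊ := by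
  calc R = Real.exp (Real.log R) := (Real.exp_log hR).symm
    _ ≤ Real.exp (⌈Real.log R⌉₊ * 1) := by
        rw [mul_one]
        exact Real.exp_le_exp.2 (Nat.le_ceil _)
    _ = Real.exp 1 ^ ⌈Real.log R⌉₊ := Real.exp_nat_mul 1 _
    _ ≤ 3 ^ ⌈Real.log R⌉₊ := by
        gcongr
        exact Real.exp_one_lt_three.le

lemma le_two_thirds_pow_of_cutoff_bound {m L P : ℕ} (hm : 1 ≤ m) {δ θ M R : ℝ} (hδ : 0 ≤ δ)
    (hM : 0 < M) (hR : 0 ≤ R) (hRL : R ≤ 3 ^ L) (hθ : 1 / 2 ≤ θ ^ P)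
    (h : δ * ((3 / 4) ^ (2 * (m * L)) * (θ * M) ^ (P * L)) ≤
      (1 / 4) ^ (2 * (m * L)) * (M ^ (P * L) * (2 * R) ^ m)) :
    δ ≤ 2 ^ m * (2 / 3) ^ L := by
  have hMp : 0 < M ^ (P * L) := by positivity
  have h1 : δ * (1 / 2) ^ L ≤ δ * θ ^ (P * L) := by
    rw [pow_mul]
    gcongr
  have h34 : (3 / 4 : ℝ) ^ (2 * (m * L)) = (1 / 4) ^ (2 * (m * L)) * (9 : ℝ) ^ (m * L) := by
    rw [pow_mul _ 2 (m * L), pow_mul _ 2 (m * L), ← mul_pow]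
    norm_num
  have h2 : 9 ^ (m * L) * (δ * θ ^ (P * L)) ≤ (2 * R) ^ m := by
    have hpos : (0 : ℝ) < (1 / 4) ^ (2 * (m * L)) * M ^ (P * L) := by positivity
    refine le_of_mul_le_mul_left ?_ hpos
    rw [h34, mul_pow] at h
    linarith
  have h3 : (2 * R) ^ m ≤ 2 ^ m * 3 ^ (m * L) := by
    rw [mul_pow, mul_comm m L, pow_mul]
    gcongr
  have h9 : (9 : ℝ) ^ (m * L) = 3 ^ (m * L) * 3 ^ (m * L) := by
    rw [← mul_pow]
    norm_num
  have h4 : 3 ^ (m * L) * (δ * (1 / 2) ^ L) ≤ 2 ^ m := by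
    refine le_of_mul_le_mul_left ?_ (show (0 : ℝ) < 3 ^ (m * L) by positivity)
    have h5 := mul_le_mul_of_nonneg_left h1 (show (0 : ℝ) ≤ 9 ^ (m * L) by positivity)
    rw [h9] at h5 h2
    linarith
  have h6 : 3 ^ L * (δ * (1 / 2) ^ L) ≤ 2 ^ m := by
    refine le_trans ?_ h4
    gcongr
    · norm_num
    · nlinarith
  have h7 : (3 : ℝ) ^ L * (1 / 2) ^ L * (2 / 3) ^ L = 1 := by
    rw [← mul_pow, ← mul_pow]
    norm_num
  calc δ = 3 ^ L * (δ * (1 / 2) ^ L) * (2 / 3) ^ L := by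
        linear_combination (-δ) * h7
    _ ≤ 2 ^ m * (2 / 3) ^ L := by gcongr

/-- **q-boundary weak maximum principle on the halfspace for the operator `L_T`**
(instance of Theorem 3.5 of the paper, class `B₂`).  On the closed upper halfspace
`H = {x ∈ ℝ^m : x_m ≥ 0}`, given a `C¹` field `T` of symmetric positive definite matrices
pinched between `T₋(|x|)` and `T₊(|x|)`, with `Θ(t) = max_{[0,t]} T₊`, a nondecreasing
`Q > 0` with `Θ(t)Q(t) = o(t²)` and `liminf Θ(t)Q(t)·log t/t² < ∞`, a function `q` with
`0 ≤ q(x) ≤ Q(|x|)`, and a `C²` function `u` bounded above with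
`⟨T∇u, ν⟩ ≤ 0` on `∂H` (`ν = -e_m`), then for every `γ < sup_H u`,
`inf {q(x)·div(T∇u)(x) : x ∈ H, u(x) > γ} ≤ 0`. -/
theorem halfspace_boundary_weak_maximum_principle (m : ℕ) (hm : 2 ≤ m)
    (T : EuclideanSpace ℝ (Fin m) → Matrix (Fin m) (Fin m) ℝ)
    (hTsymm : ∀ x, (T x).IsSymm)
    (hTC1 : ∀ i j : Fin m, ContDiff ℝ 1 (fun x => T x i j))
    (Tminus Tplus : ℝ → ℝ)
    (hTminusC : ContinuousOn Tminus (Set.Ici 0)) (hTplusC : ContinuousOn Tplus (Set.Ici 0))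
    (hTminusPos : ∀ t : ℝ, 0 ≤ t → 0 < Tminus t) (hTplusPos : ∀ t : ℝ, 0 ≤ t → 0 < Tplus t)
    (hTlow : ∀ (x X : EuclideanSpace ℝ (Fin m)),
      Tminus ‖x‖ * ‖X‖ ^ 2 ≤ ∑ i, ∑ j, T x i j * X i * X j)
    (hThigh : ∀ (x X : EuclideanSpace ℝ (Fin m)),
      ∑ i, ∑ j, T x i j * X i * X j ≤ Tplus ‖x‖ * ‖X‖ ^ 2)
    (Θ : ℝ → ℝ) (hΘ : ∀ t : ℝ, 0 ≤ t → Θ t = sSup (Tplus '' Set.Icc 0 t))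
    (Q : ℝ → ℝ) (hQpos : ∀ t : ℝ, 0 ≤ t → 0 < Q t) (hQmono : MonotoneOn Q (Set.Ici 0))
    (hlittleo : (fun t => Θ t * Q t) =o[atTop] fun t => t ^ 2)
    (hliminf : ∃ C : ℝ, ∃ᶠ t in atTop, Θ t * Q t * Real.log t / t ^ 2 ≤ C)
    (q : EuclideanSpace ℝ (Fin m) → ℝ)
    (hqc : ContinuousOn q {x : EuclideanSpace ℝ (Fin m) | 0 ≤ x ⟨m - 1, by omega⟩})
    (hq0 : ∀ x : EuclideanSpace ℝ (Fin m), 0 ≤ x ⟨m - 1, by omega⟩ → 0 ≤ q x)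
    (hqQ : ∀ x : EuclideanSpace ℝ (Fin m), 0 ≤ x ⟨m - 1, by omega⟩ → q x ≤ Q ‖x‖)
    (u : EuclideanSpace ℝ (Fin m) → ℝ)
    (hu : ∀ x : EuclideanSpace ℝ (Fin m), 0 ≤ x ⟨m - 1, by omega⟩ → ContDiffAt ℝ 2 u x)
    (hbdd : BddAbove (u '' {x : EuclideanSpace ℝ (Fin m) | 0 ≤ x ⟨m - 1, by omega⟩}))
    (hbdy : ∀ x : EuclideanSpace ℝ (Fin m), x ⟨m - 1, by omega⟩ = 0 →
      0 ≤ ∑ j, T x ⟨m - 1, by omega⟩ j * pderivE j u x)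
    (γ : ℝ)
    (hγ : γ < sSup (u '' {x : EuclideanSpace ℝ (Fin m) | 0 ≤ x ⟨m - 1, by omega⟩})) :
    sInf {y : ℝ | ∃ x : EuclideanSpace ℝ (Fin m), 0 ≤ x ⟨m - 1, by omega⟩ ∧ γ < u x ∧
      y = q x * ∑ i, pderivE i (fun z => ∑ j, T z i j * pderivE j u z) x} ≤ 0 := by
  obtain ⟨n, rfl⟩ : ∃ n, m = n + 1 := ⟨m - 1, by omega⟩
  generalize (⟨n + 1 - 1, by omega⟩ : Fin (n + 1)) = l at *
  by_contra! hpos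
  set S := {y : ℝ | ∃ x : EuclideanSpace ℝ (Fin (n + 1)), 0 ≤ x l ∧ γ < u x ∧
      y = q x * ∑ i, pderivE i (fun z => ∑ j, T z i j * pderivE j u z) x} with hS
  set c := sInf S with hc
  have hSb : BddBelow S := by
    by_contra h
    exact hpos.ne' (Real.sInf_of_not_bddBelow h)
  set us := sSup (u '' {x : EuclideanSpace ℝ (Fin (n + 1)) | 0 ≤ x l}) with hus
  set M := us - γ with hM
  have hM0 : 0 < M := sub_pos.2 hγ
  have huM : ∀ x : EuclideanSpace ℝ (Fin (n + 1)), 0 ≤ x l → u x - γ ≤ M := fun x hx =>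
    sub_le_sub_right (le_csSup hbdd ⟨x, hx, rfl⟩) γ
  obtain ⟨C, hC⟩ := hliminf
  set C' := max C 1 with hC'
  have hC'0 : 0 < C' := lt_of_lt_of_le one_pos (le_max_right _ _)
  obtain ⟨P, hP⟩ := exists_nat_ge (max 2 (256 * ((n + 1 : ℕ) : ℝ) ^ 2 * M * C' / c))
  have hP2 : (2 : ℝ) ≤ P := (le_max_left _ _).trans hP
  have hPc : 256 * ((n + 1 : ℕ) : ℝ) ^ 2 * M * C' ≤ P * c :=
    (div_le_iff₀ hpos).1 ((le_max_right _ _).trans hP)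
  have hP2' : 2 ≤ P := by exact_mod_cast hP2
  set θ : ℝ := 1 + -(1 / (2 * P)) with hθ
  have hPinv : 1 / (2 * (P : ℝ)) ≤ 1 / 4 := by
    apply one_div_le_one_div_of_le <;> linarith
  have hPinv0 : 0 < 1 / (2 * (P : ℝ)) := by positivity
  have hθ0 : 0 ≤ θ := by linarith
  have hθP : 1 / 2 ≤ θ ^ P := by
    refine le_trans (le_of_eq ?_) (one_add_mul_le_pow (by linarith) P)
    field_simp
    norm_num
  have hlev : γ + θ * M < us := by
    have : us = γ + M := by rw [hM]; ring
    rw [this]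
    nlinarith
  obtain ⟨_, ⟨x₀, hx₀, rfl⟩, hux₀⟩ := exists_lt_of_lt_csSup
    (Set.Nonempty.image u ⟨(0 : EuclideanSpace ℝ (Fin (n + 1))), le_refl (0 : ℝ)⟩) hlev
  have huc : ∀ x : EuclideanSpace ℝ (Fin (n + 1)), 0 ≤ x l → ContinuousAt u x :=
    fun x hx => (hu x hx).continuousAt
  obtain ⟨y₁, r, R₀, hr, hball⟩ := exists_ball_subset_superlevel l huc hx₀ hux₀
  set δ := volume.real (Metric.ball y₁ r) with hδ
  have hδ0 : 0 < δ := ENNReal.toReal_pos (Metric.measure_ball_pos volume y₁ hr).ne'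
    measure_ball_lt_top.ne
  have hsmall : ∀ᶠ R : ℝ in atTop, 2 ^ (n + 1) * (2 / 3 : ℝ) ^ ⌈Real.log R⌉₊ < δ := by
    have h := tendsto_two_thirds_pow_ceil_log.const_mul ((2 : ℝ) ^ (n + 1))
    rw [mul_zero] at h
    exact h.eventually (gt_mem_nhds hδ0)
  obtain ⟨R, hCR, hRδ, hlog, hRR, hR⟩ := (hC.and_eventually (hsmall.and
    ((Real.tendsto_log_atTop.eventually_ge_atTop 1).and
      ((eventually_ge_atTop (2 * R₀)).and (eventually_gt_atTop 0))))).exists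
  set L := ⌈Real.log R⌉₊ with hL
  have hL1 : 1 ≤ L := Nat.one_le_ceil_iff.2 (by linarith)
  have hL2 : (L : ℝ) ≤ 2 * Real.log R := by
    have := (Nat.ceil_lt_add_one (show 0 ≤ Real.log R by linarith)).le
    linarith
  have hTle : ∀ s, 0 ≤ s → s ≤ R → Tplus s ≤ Θ R := by
    intro s hs0 hsR
    rw [hΘ R hR.le]
    refine le_csSup ?_ ⟨s, ⟨hs0, hsR⟩, rfl⟩
    exact (isCompact_Icc.image_of_continuousOn
      (hTplusC.mono Set.Icc_subset_Ici_self)).bddAbove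
  have hΘ0 : 0 < Θ R := (hTplusPos R hR.le).trans_le (hTle R hR.le le_rfl)
  have hQ0 := hQpos R hR.le
  have hLu : ∀ x : EuclideanSpace ℝ (Fin (n + 1)), 0 ≤ x l → γ < u x → ‖x‖ ≤ R →
      c / Q R ≤ ∑ i, pderivE i (fun z => ∑ j, T z i j * pderivE j u z) x := by
    intro x hx hux hxR
    have h1 : c ≤ q x * ∑ i, pderivE i (fun z => ∑ j, T z i j * pderivE j u z) x :=
      csInf_le hSb ⟨x, hx, hux, rfl⟩
    have h2 := hq0 x hx
    have h3 : 0 < ∑ i, pderivE i (fun z => ∑ j, T z i j * pderivE j u z) x :=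
      pos_of_mul_pos_right (hpos.trans_le h1) h2
    rw [div_le_iff₀ hQ0, mul_comm]
    refine h1.trans (mul_le_mul_of_nonneg_right ?_ h3.le)
    exact (hqQ x hx).trans (hQmono (norm_nonneg x) hR.le hxR)
  have hmL : 2 ≤ (n + 1) * L := by nlinarith
  have hPL : 2 ≤ P * L := by nlinarith
  obtain ⟨κ, hκ⟩ : ∃ κ, (n + 1) * L = κ + 1 := ⟨(n + 1) * L - 1, by omega⟩
  obtain ⟨π, hπ⟩ : ∃ π, P * L = π + 2 := ⟨P * L - 2, by omega⟩
  have hκ' : (κ : ℝ) + 1 = ((n + 1 : ℕ) : ℝ) * L := by exact_mod_cast hκ.symm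
  have hπ' : (π : ℝ) + 2 = P * L := by exact_mod_cast hπ.symm
  have hgrowth : L * (Θ R * Q R) ≤ 2 * C' * R ^ 2 := by
    have h1 : Θ R * Q R * Real.log R ≤ C' * R ^ 2 := by
      rw [← div_le_iff₀ (by positivity)]
      exact hCR.trans (le_max_left _ _)
    have h2 := mul_le_mul_of_nonneg_right hL2 (mul_pos hΘ0 hQ0).le
    linarith
  have hε : ((κ : ℝ) + 1) ^ 2 * (M * (4 * Θ R / R ^ 2)) / (π + 2)
      ≤ c / Q R * ((1 / 4) ^ 2 / 2) := by
    have hL0 : (0 : ℝ) < L := by exact_mod_cast hL1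
    have hP0 : (0 : ℝ) < P := by linarith
    have h1 : 128 * ((n + 1 : ℕ) : ℝ) ^ 2 * M * (L * (Θ R * Q R)) ≤ P * c * R ^ 2 := by
      have h2 := mul_le_mul_of_nonneg_left hgrowth
        (show 0 ≤ 128 * ((n + 1 : ℕ) : ℝ) ^ 2 * M by positivity)
      have h3 := mul_le_mul_of_nonneg_right hPc (sq_nonneg R)
      linarith
    have h4 : ((κ : ℝ) + 1) ^ 2 * (M * (4 * Θ R / R ^ 2)) / (π + 2)
        = 128 * ((n + 1 : ℕ) : ℝ) ^ 2 * M * (L * (Θ R * Q R)) / (32 * P * R ^ 2 * Q R) := by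
      rw [hκ', hπ']
      field_simp
      ring
    have h5 : c / Q R * ((1 / 4) ^ 2 / 2) = P * c * R ^ 2 / (32 * P * R ^ 2 * Q R) := by
      field_simp
      norm_num
    rw [h4, h5]
    gcongr
  have hupper := integral_cutoff_mul_pow_le l hTsymm hTC1
    (fun x X => le_trans (mul_nonneg (hTminusPos _ (norm_nonneg x)).le (sq_nonneg _)) (hTlow x X))
    hR (div_pos hpos hQ0) hM0.le (by norm_num) hΘ0.le
    (fun x X hx => (hThigh x X).trans
      (mul_le_mul_of_nonneg_right (hTle _ (norm_nonneg x) hx) (sq_nonneg _)))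
    hu huM hbdy hLu (κ := κ) (π := π) (by omega) hε
  have hlower := volume_ball_mul_le_integral_cutoff l huc (mul_nonneg hθ0 hM0.le) hR hRR hball
    (2 * κ + 2) (π + 2)
  have hfin := hlower.trans hupper
  rw [← hπ, show 2 * κ + 2 = 2 * ((n + 1) * L) by omega] at hfin
  exact (le_two_thirds_pow_of_cutoff_bound (by omega) hδ0.le hM0 hR.le
    (le_three_pow_ceil_log hR) hθP hfin).not_gt hRδ
end

section
/- Let m ≥ 2 and H = {x ∈ ℝ^m : x_m ≥ 0} the closed upper halfspace. Let Q : [0,∞) → (0,∞) be nondecreasing with Q(t) = o(t²) as t → +∞ and liminf_{t→+∞} Q(t)·log t / t² < +∞. Let u be C² on an open neighborhood of H with u* = sup_H u < +∞ and ∂u/∂x_m(x) ≥ 0 at every boundary point x (with x_m = 0). Let f : ℝ → ℝ be continuous and let b be a continuous positive function on H with b(x) ≥ 1/Q(|x|) outside a compact subset of H. If Δu ≥ b(x)·f(u) on Ω_γ = {x ∈ H : u(x) > γ} for some γ < u*, then f(u*) ≤ 0. -/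
open Filter

open Set Topology

/-- One-sided second derivative test at a maximum over `[0, ∞)`. -/
theorem second_deriv_nonpos_of_right_max {g g' : ℝ → ℝ} {d : ℝ}
    (hg : ∀ᶠ t in 𝓝 0, HasDerivAt g (g' t) t) (hg' : HasDerivAt g' d 0) (h0 : 0 ≤ g' 0)
    (hmax : ∀ᶠ t in 𝓝[>] 0, g t ≤ g 0) : d ≤ 0 := by
  by_contra! hd
  have hslope : ∀ᶠ t in 𝓝[>] (0 : ℝ), 0 < slope g' 0 t :=
    ((hasDerivAt_iff_tendsto_slope.1 hg').mono_left (nhdsGT_le_nhdsNE 0)).eventually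
      (lt_mem_nhds hd)
  have hpos : ∀ᶠ t in 𝓝[>] (0 : ℝ), 0 < g' t := by
    filter_upwards [hslope, self_mem_nhdsWithin] with t ht ht0
    rw [slope_def_field, sub_zero] at ht
    have := (div_pos_iff_of_pos_right (show (0 : ℝ) < t from ht0)).1 ht
    linarith
  obtain ⟨e₁, he₁, H₁⟩ := Metric.eventually_nhds_iff.1 hg
  obtain ⟨e₂, he₂, H₂⟩ := mem_nhdsGT_iff_exists_Ioo_subset.1 (hpos.and hmax)
  have he₂ : (0 : ℝ) < e₂ := he₂
  obtain ⟨r, hr0, hr⟩ := exists_between (lt_min he₁ he₂)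
  have hr1 : r < e₁ := hr.trans_le (min_le_left _ _)
  have hr2 : r < e₂ := hr.trans_le (min_le_right _ _)
  have hder : ∀ t ∈ Icc 0 r, HasDerivAt g (g' t) t := fun t ht => H₁ (by
    rw [Real.dist_eq, sub_zero, abs_of_nonneg ht.1]
    exact ht.2.trans_lt hr1)
  obtain ⟨c, hc, hceq⟩ := exists_hasDerivAt_eq_slope g g' hr0
    (fun t ht => (hder t ht).continuousAt.continuousWithinAt)
    (fun t ht => hder t (Ioo_subset_Icc_self ht))
  have h1 := (H₂ ⟨hc.1, hc.2.trans hr2⟩).1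
  have h2 := (H₂ ⟨hr0, hr2⟩).2
  rw [hceq, sub_zero] at h1
  have := (div_pos_iff_of_pos_right hr0).1 h1
  linarith

/-- The derivatives of `u` along a coordinate line are given by `pderivE`. -/
theorem hasDerivAt_coordinate_line {m : ℕ} (i : Fin m) {u : EuclideanSpace ℝ (Fin m) → ℝ}
    {x : EuclideanSpace ℝ (Fin m)} {t : ℝ}
    (hu : DifferentiableAt ℝ u (x + t • EuclideanSpace.single i 1)) :
    HasDerivAt (fun s : ℝ => u (x + s • EuclideanSpace.single i 1))
      (pderivE i u (x + t • EuclideanSpace.single i 1)) t := by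
  have hl : HasDerivAt (fun s : ℝ => x + s • EuclideanSpace.single i (1 : ℝ))
      (EuclideanSpace.single i (1 : ℝ)) t := by
    simpa using ((hasDerivAt_id t).smul_const (EuclideanSpace.single i (1 : ℝ))).const_add x
  exact hu.hasFDerivAt.comp_hasDerivAt t hl

theorem norm_sq_add_smul_single {m : ℕ} (i : Fin m) (x : EuclideanSpace ℝ (Fin m)) (t : ℝ) :
    ‖x + t • EuclideanSpace.single i (1 : ℝ)‖ ^ 2 = ‖x‖ ^ 2 + 2 * t * x i + t ^ 2 := by
  rw [norm_add_sq_real, inner_smul_right, norm_smul]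
  simp [EuclideanSpace.inner_single_right]
  ring

/-- At a maximum point of `u - δ log (1 + |x|²)` along a coordinate half-line, at which `u` has
nonnegative derivative in that direction or which is also a maximum in the opposite direction, the
second derivative of `u` is at most `2δ / (1 + |x|²)`. -/
theorem pderivE_pderivE_le_of_max {m : ℕ} (i : Fin m) {u : EuclideanSpace ℝ (Fin m) → ℝ}
    {x : EuclideanSpace ℝ (Fin m)} {δ : ℝ} (hδ : 0 ≤ δ) (hu : ContDiffAt ℝ 2 u x)
    (hmax : ∀ᶠ t in 𝓝[>] (0 : ℝ), u (x + t • EuclideanSpace.single i 1) -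
      δ * Real.log (1 + ‖x + t • EuclideanSpace.single i (1 : ℝ)‖ ^ 2) ≤
      u x - δ * Real.log (1 + ‖x‖ ^ 2))
    (hor : (x i = 0 ∧ 0 ≤ pderivE i u x) ∨
      ∀ᶠ t in 𝓝 (0 : ℝ), u (x + t • EuclideanSpace.single i 1) -
      δ * Real.log (1 + ‖x + t • EuclideanSpace.single i (1 : ℝ)‖ ^ 2) ≤
      u x - δ * Real.log (1 + ‖x‖ ^ 2)) :
    pderivE i (pderivE i u) x ≤ 2 * δ / (1 + ‖x‖ ^ 2) := by
  have hq : ∀ t : ℝ, 0 < 1 + (‖x‖ ^ 2 + 2 * t * x i + t ^ 2) := fun t => by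
    rw [← norm_sq_add_smul_single]
    positivity
  simp only [norm_sq_add_smul_single] at hmax hor
  set g : ℝ → ℝ := fun t => u (x + t • EuclideanSpace.single i 1) -
    δ * Real.log (1 + (‖x‖ ^ 2 + 2 * t * x i + t ^ 2)) with hgdef
  set g' : ℝ → ℝ := fun t => pderivE i u (x + t • EuclideanSpace.single i 1) -
    δ * ((2 * x i + 2 * t) / (1 + (‖x‖ ^ 2 + 2 * t * x i + t ^ 2))) with hg'def
  have hg0 : g 0 = u x - δ * Real.log (1 + ‖x‖ ^ 2) := by simp [hgdef]
  have hpoly : ∀ t : ℝ, HasDerivAt (fun t : ℝ => 1 + (‖x‖ ^ 2 + 2 * t * x i + t ^ 2))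
      (2 * x i + 2 * t) t := fun t => by
    have h1 : HasDerivAt (fun t : ℝ => 2 * t * x i) (2 * x i) t := by
      simpa using ((hasDerivAt_id t).const_mul 2).mul_const (x i)
    have h2 : HasDerivAt (fun t : ℝ => t ^ 2) (2 * t) t := by
      simpa using hasDerivAt_pow 2 t
    exact ((h1.const_add (‖x‖ ^ 2)).add h2).const_add 1
  have htend : Tendsto (fun t : ℝ => x + t • EuclideanSpace.single i (1 : ℝ)) (𝓝 0) (𝓝 x) := by
    have : Continuous (fun t : ℝ => x + t • EuclideanSpace.single i (1 : ℝ)) := by fun_prop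
    simpa using this.tendsto 0
  have hdu : ∀ᶠ y in 𝓝 x, DifferentiableAt ℝ u y :=
    (hu.eventually (by simp)).mono fun y hy => hy.differentiableAt (by norm_num)
  have hg : ∀ᶠ t in 𝓝 0, HasDerivAt g (g' t) t := by
    filter_upwards [htend.eventually hdu] with t ht
    exact (hasDerivAt_coordinate_line i ht).sub (((hpoly t).log (hq t).ne').const_mul δ)
  have hdp : DifferentiableAt ℝ (pderivE i u) x := by
    have h1 : ContDiffAt ℝ 1 (fderiv ℝ u) x := hu.fderiv_right (by norm_num)
    exact (h1.differentiableAt (by norm_num)).clm_apply (differentiableAt_const _)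
  have hg' : HasDerivAt g' (pderivE i (pderivE i u) x -
      δ * ((2 * (1 + ‖x‖ ^ 2) - 2 * x i * (2 * x i)) / (1 + ‖x‖ ^ 2) ^ 2)) 0 := by
    have h1 := hasDerivAt_coordinate_line (x := x) (t := 0) (u := pderivE i u) i
      (by simpa using hdp)
    have h2 : HasDerivAt (fun t : ℝ => 2 * x i + 2 * t) 2 0 := by
      simpa using ((hasDerivAt_id (0 : ℝ)).const_mul 2).const_add (2 * x i)
    have h3 : HasDerivAt g' _ 0 := h1.sub ((h2.div (hpoly 0) (hq 0).ne').const_mul δ)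
    convert h3 using 1
    simp
  have h0 : 0 ≤ g' 0 := by
    rcases hor with ⟨hx, hp⟩ | hloc
    · simpa [hg'def, hx] using hp
    · have hloc' : IsLocalMax g 0 := by
        filter_upwards [hloc] with t ht
        rw [hg0]
        exact ht
      exact (hloc'.hasDerivAt_eq_zero hg.self_of_nhds).ge
  have key := second_deriv_nonpos_of_right_max hg hg' h0 (by simpa only [hg0] using hmax)
  have hpos : 0 < 1 + ‖x‖ ^ 2 := by positivity
  have hle : (2 * (1 + ‖x‖ ^ 2) - 2 * x i * (2 * x i)) / (1 + ‖x‖ ^ 2) ^ 2 ≤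
      2 / (1 + ‖x‖ ^ 2) := by
    rw [div_le_div_iff₀ (by positivity) hpos]
    nlinarith [mul_nonneg (sq_nonneg (x i)) hpos.le]
  calc pderivE i (pderivE i u) x
      ≤ δ * ((2 * (1 + ‖x‖ ^ 2) - 2 * x i * (2 * x i)) / (1 + ‖x‖ ^ 2) ^ 2) := by linarith
    _ ≤ δ * (2 / (1 + ‖x‖ ^ 2)) := by gcongr
    _ = 2 * δ / (1 + ‖x‖ ^ 2) := by ring

/-- At a maximum point over the halfspace `{x | 0 ≤ x k}` of `u - δ log (1 + |x|²)`, where `u`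
satisfies the boundary condition `0 ≤ ∂ₖ u`, the Laplacian of `u` is at most
`2mδ / (1 + |x|²)`. -/
theorem laplacianE_le_of_isMaxOn {m : ℕ} (k : Fin m) {u : EuclideanSpace ℝ (Fin m) → ℝ}
    {x : EuclideanSpace ℝ (Fin m)} {δ : ℝ} (hδ : 0 ≤ δ) (hu : ContDiffAt ℝ 2 u x)
    (hx : 0 ≤ x k) (hbdy : x k = 0 → 0 ≤ pderivE k u x)
    (hmax : IsMaxOn (fun y => u y - δ * Real.log (1 + ‖y‖ ^ 2)) {y | 0 ≤ y k} x) :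
    laplacianE u x ≤ m * (2 * δ / (1 + ‖x‖ ^ 2)) := by
  have hterm : ∀ i, pderivE i (pderivE i u) x ≤ 2 * δ / (1 + ‖x‖ ^ 2) := fun i => by
    refine pderivE_pderivE_le_of_max i hδ hu ?_ ?_
    · filter_upwards [self_mem_nhdsWithin] with t ht
      refine hmax ?_
      have ht : 0 < t := ht
      by_cases hik : k = i
      · subst hik
        simp only [mem_ofPred_eq, PiLp.add_apply, PiLp.smul_apply, PiLp.single_apply,
          if_true, smul_eq_mul]
        linarith
      · simp [hik, hx]
    · by_cases hik : k = i
      · subst hik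
        rcases hx.eq_or_lt with h | h
        · exact Or.inl ⟨h.symm, hbdy h.symm⟩
        · right
          filter_upwards [lt_mem_nhds (neg_lt_zero.2 h)] with t ht
          refine hmax ?_
          simp only [mem_ofPred_eq, PiLp.add_apply, PiLp.smul_apply, PiLp.single_apply,
            if_true, smul_eq_mul]
          linarith
      · right
        refine Eventually.of_forall fun t => hmax ?_
        simp [hik, hx]
  calc laplacianE u x ≤ ∑ _i : Fin m, 2 * δ / (1 + ‖x‖ ^ 2) :=
        Finset.sum_le_sum fun i _ => hterm i
    _ = m * (2 * δ / (1 + ‖x‖ ^ 2)) := by simp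

/-- A positive continuous function on a closed set `s` that dominates `1 / Q(|x|)` outside a compact
set, with `Q(t) = o(t²)`, dominates a positive multiple of `1 / (1 + |x|²)` on `s`. -/
theorem exists_pos_le_mul_one_add_norm_sq {m : ℕ} {Q : ℝ → ℝ} (hQpos : ∀ t : ℝ, 0 ≤ t → 0 < Q t)
    (hQ : (fun t => Q t) =o[atTop] fun t => t ^ 2) {s K : Set (EuclideanSpace ℝ (Fin m))}
    (hs : IsClosed s) (hK : IsCompact K) {b : EuclideanSpace ℝ (Fin m) → ℝ}
    (hbc : ContinuousOn b s) (hbpos : ∀ x ∈ s, 0 < b x)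
    (hbQ : ∀ x ∈ s, x ∉ K → 1 / Q ‖x‖ ≤ b x) :
    ∃ c > 0, ∀ x ∈ s, c ≤ b x * (1 + ‖x‖ ^ 2) := by
  obtain ⟨R, hR⟩ := eventually_atTop.1 (hQ.bound one_pos)
  have hL : IsCompact ((K ∪ Metric.closedBall 0 R) ∩ s) :=
    (hK.union (isCompact_closedBall 0 R)).inter_right hs
  obtain ⟨β, hβ, hβb⟩ : ∃ β > 0, ∀ x ∈ (K ∪ Metric.closedBall 0 R) ∩ s, β ≤ b x :=
    hL.exists_forall_le' (hbc.mono inter_subset_right) fun x hx => hbpos x hx.2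
  refine ⟨min β 1, lt_min hβ one_pos, fun x hx => ?_⟩
  by_cases hxL : x ∈ K ∪ Metric.closedBall 0 R
  · have h1 := hβb x ⟨hxL, hx⟩
    have h2 := min_le_left β 1
    nlinarith [mul_nonneg (hbpos x hx).le (sq_nonneg ‖x‖)]
  · rw [mem_union, not_or, mem_closedBall_zero_iff, not_le] at hxL
    have hq := hQpos ‖x‖ (norm_nonneg x)
    have h1 := hR ‖x‖ hxL.2.le
    rw [Real.norm_of_nonneg hq.le, Real.norm_of_nonneg (sq_nonneg _), one_mul] at h1
    have h2 := hbQ x hx hxL.1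
    calc min β 1 ≤ 1 := min_le_right _ _
      _ ≤ 1 / Q ‖x‖ * (1 + ‖x‖ ^ 2) := by
        rw [one_div, ← div_eq_inv_mul, one_le_div hq]
        linarith
      _ ≤ b x * (1 + ‖x‖ ^ 2) := by gcongr

/-- Instance on the closed upper halfspace `H = {x ∈ ℝ^m : x_m ≥ 0}`, with classical `C²`
regularity, of **Theorem 3.7** of the paper.  `Q : [0,∞) → (0,∞)` is nondecreasing with
`Q(t) = o(t²)` and `liminf Q(t)·log t/t² < ∞`; `u` is `C²` near `H`, bounded above, with
`∂u/∂x_m ≥ 0` on `∂H` (i.e. `∂_ν u ≤ 0` for the outward normal `ν = -e_m`); `f` is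
continuous, `b` is continuous and positive with `b(x) ≥ 1/Q(|x|)` outside a compact set; if
`Δu ≥ b·f(u)` on `Ω_γ = {x ∈ H : u(x) > γ}` for some `γ < u* = sup_H u`, then `f(u*) ≤ 0`. -/
theorem halfspace_wmp_consequence (m : ℕ) (hm : 2 ≤ m)
    (Q : ℝ → ℝ) (hQpos : ∀ t : ℝ, 0 ≤ t → 0 < Q t) (hQmono : MonotoneOn Q (Set.Ici 0))
    (hlittleo : (fun t => Q t) =o[atTop] fun t => t ^ 2)
    (hliminf : ∃ C : ℝ, ∃ᶠ t in atTop, Q t * Real.log t / t ^ 2 ≤ C)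
    (u : EuclideanSpace ℝ (Fin m) → ℝ)
    (hu : ∀ x : EuclideanSpace ℝ (Fin m), 0 ≤ x ⟨m - 1, by omega⟩ → ContDiffAt ℝ 2 u x)
    (hbdd : BddAbove (u '' {x : EuclideanSpace ℝ (Fin m) | 0 ≤ x ⟨m - 1, by omega⟩}))
    (hbdy : ∀ x : EuclideanSpace ℝ (Fin m), x ⟨m - 1, by omega⟩ = 0 →
      0 ≤ pderivE (⟨m - 1, by omega⟩ : Fin m) u x)
    (f : ℝ → ℝ) (hf : Continuous f)
    (b : EuclideanSpace ℝ (Fin m) → ℝ)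
    (hbc : ContinuousOn b {x : EuclideanSpace ℝ (Fin m) | 0 ≤ x ⟨m - 1, by omega⟩})
    (hbpos : ∀ x : EuclideanSpace ℝ (Fin m), 0 ≤ x ⟨m - 1, by omega⟩ → 0 < b x)
    (K : Set (EuclideanSpace ℝ (Fin m))) (hK : IsCompact K)
    (hbQ : ∀ x : EuclideanSpace ℝ (Fin m), 0 ≤ x ⟨m - 1, by omega⟩ → x ∉ K →
      1 / Q ‖x‖ ≤ b x)
    (γ : ℝ)
    (hγ : γ < sSup (u '' {x : EuclideanSpace ℝ (Fin m) | 0 ≤ x ⟨m - 1, by omega⟩}))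
    (hineq : ∀ x : EuclideanSpace ℝ (Fin m), 0 ≤ x ⟨m - 1, by omega⟩ → γ < u x →
      b x * f (u x) ≤ laplacianE u x) :
    f (sSup (u '' {x : EuclideanSpace ℝ (Fin m) | 0 ≤ x ⟨m - 1, by omega⟩})) ≤ 0 := by
  set k : Fin m := ⟨m - 1, by omega⟩ with hk
  set H : Set (EuclideanSpace ℝ (Fin m)) := {x | 0 ≤ x k} with hH
  set S : ℝ := sSup (u '' H) with hS
  have hHcl : IsClosed H := isClosed_le continuous_const (by fun_prop)
  have hle : ∀ x ∈ H, u x ≤ S := fun x hx => le_csSup hbdd (mem_image_of_mem u hx)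
  by_contra! hfS
  obtain ⟨c, hc, hcb⟩ := exists_pos_le_mul_one_add_norm_sq hQpos hlittleo hHcl hK hbc hbpos hbQ
  have hev : ∀ᶠ s in 𝓝 S, f S / 2 < f s ∧ γ < s :=
    (hf.continuousAt.eventually (lt_mem_nhds (half_lt_self hfS))).and (lt_mem_nhds hγ)
  obtain ⟨ε, hε, hεS⟩ := Metric.eventually_nhds_iff.1 hev
  obtain ⟨_, ⟨y, hy, rfl⟩, hyS⟩ := exists_lt_of_lt_csSup
    (⟨u 0, 0, by simp [hH], rfl⟩ : (u '' H).Nonempty) (sub_lt_self S hε)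
  have hlog : ∀ x : EuclideanSpace ℝ (Fin m), 0 ≤ Real.log (1 + ‖x‖ ^ 2) := fun x =>
    Real.log_nonneg (by linarith [sq_nonneg ‖x‖])
  have hsmall : ∀ᶠ δ in 𝓝[>] (0 : ℝ), δ * Real.log (1 + ‖y‖ ^ 2) < u y - (S - ε) ∧
      m * (2 * δ) < c * (f S / 2) := by
    refine Eventually.filter_mono nhdsWithin_le_nhds (Eventually.and ?_ ?_)
    · refine (show Continuous fun δ : ℝ => δ * Real.log (1 + ‖y‖ ^ 2) by
        fun_prop).continuousAt.eventually (gt_mem_nhds ?_)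
      simp only [zero_mul]
      linarith
    · refine (show Continuous fun δ : ℝ => (m : ℝ) * (2 * δ) by
        fun_prop).continuousAt.eventually (gt_mem_nhds ?_)
      simp only [mul_zero]
      positivity
  obtain ⟨δ, ⟨hδy, hδm⟩, hδ⟩ := (hsmall.and self_mem_nhdsWithin).exists
  have hδ : 0 < δ := hδ
  have hcont : ContinuousOn (fun x => u x - δ * Real.log (1 + ‖x‖ ^ 2)) H := by
    refine ContinuousOn.sub (fun x hx => (hu x hx).continuousAt.continuousWithinAt) ?_
    refine continuousOn_const.mul (ContinuousOn.log (by fun_prop) fun x _ => ?_)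
    positivity
  have htop : Tendsto (fun x : EuclideanSpace ℝ (Fin m) => δ * Real.log (1 + ‖x‖ ^ 2))
      (cocompact _) atTop :=
    (Real.tendsto_log_atTop.comp (tendsto_atTop_add_const_left _ 1
      ((tendsto_pow_atTop two_ne_zero).comp tendsto_norm_cocompact_atTop))).const_mul_atTop hδ
  obtain ⟨x, hx, hxmax⟩ := hcont.exists_isMaxOn' hHcl hy (by
    refine eventually_inf_principal.2 ?_
    filter_upwards [htop.eventually_ge_atTop (S - (u y - δ * Real.log (1 + ‖y‖ ^ 2)))] with z hz hzH
    linarith [hle z hzH])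
  have hlap := laplacianE_le_of_isMaxOn k hδ.le (hu x hx) hx (hbdy x) hxmax
  have hxy : u y - δ * Real.log (1 + ‖y‖ ^ 2) ≤ u x - δ * Real.log (1 + ‖x‖ ^ 2) := hxmax hy
  have hxS : dist (u x) S < ε := by
    rw [Real.dist_eq, abs_lt]
    have h1 := mul_nonneg hδ.le (hlog x)
    have h2 := hle x hx
    constructor <;> linarith
  obtain ⟨hfx, hγx⟩ := hεS hxS
  have hpos : 0 < 1 + ‖x‖ ^ 2 := by positivity
  have hchain := (hineq x hx hγx).trans hlap
  rw [← mul_div_assoc, le_div_iff₀ hpos] at hchain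
  have hlow : c * (f S / 2) ≤ b x * (1 + ‖x‖ ^ 2) * f (u x) :=
    mul_le_mul (hcb x hx) hfx.le (half_pos hfS).le (hc.le.trans (hcb x hx))
  linarith
end

section
/- Let m ≥ 2 and H = {x ∈ ℝ^m : x_m ≥ 0} the closed upper halfspace. Let Q : [0,∞) → (0,∞) be nondecreasing with Q(t) = o(t²) as t → +∞ and liminf_{t→+∞} Q(t)·log t / t² < +∞. Let b be a continuous positive function on H with b(x) ≥ 1/Q(|x|) outside a compact subset of H, and let f : ℝ → ℝ be continuous with liminf_{t→+∞} f(t)/t^σ > 0 for some σ > 1. Let u be C² on an open neighborhood of H with ∂u/∂x_m(x) ≥ 0 at every boundary point x (with x_m = 0), and suppose Δu ≥ b(x)·f(u) on Ω_γ = {x ∈ H : u(x) > γ} for some γ ∈ ℝ with γ < sup_H u ≤ +∞. Then u is bounded above on H, i.e. sup_H u < +∞. -/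
open Filter

open scoped Topology

/-- If `h ≤ W` to the right of `0` with equality at `0`, then the derivatives at `0` are ordered. -/
lemma HasDerivAt.le_of_eventually_le_right {h W : ℝ → ℝ} {d w : ℝ} (hh : HasDerivAt h d 0)
    (hW : HasDerivAt W w 0) (h0 : h 0 = W 0) (hle : ∀ᶠ s in 𝓝[>] (0 : ℝ), h s ≤ W s) :
    d ≤ w := by
  refine le_of_tendsto_of_tendsto hh.tendsto_slope_zero_right hW.tendsto_slope_zero_right ?_
  filter_upwards [hle, self_mem_nhdsWithin] with s hs hpos
  have hpos' : (0 : ℝ) < s := hpos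
  simp only [zero_add, smul_eq_mul, h0]
  gcongr

/-- The second derivative is nonnegative at a local minimum. -/
lemma IsLocalMin.second_deriv_nonneg {φ φ' : ℝ → ℝ} {c a : ℝ} (hmin : IsLocalMin φ a)
    (hφ : ∀ᶠ s in 𝓝 a, HasDerivAt φ (φ' s) s) (hφ' : HasDerivAt φ' c a) : 0 ≤ c := by
  by_contra! hc
  have hd : deriv φ =ᶠ[𝓝 a] φ' := hφ.mono fun s hs => hs.deriv
  have hdd : deriv (deriv φ) a = c := hd.deriv_eq.trans hφ'.deriv
  have hmax := isLocalMax_of_deriv_deriv_neg (hdd.trans_lt hc) hmin.deriv_eq_zero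
    hφ.self_of_nhds.continuousAt
  have hconst : φ =ᶠ[𝓝 a] fun _ => φ a := by
    filter_upwards [hmin, hmax] with s h1 h2 using le_antisymm h2 h1
  have : deriv (deriv φ) a = 0 := by
    rw [hconst.deriv.deriv_eq]; simp
  linarith

/-- If `h ≤ W` near `0` with equality at `0`, then the second derivatives at `0` are ordered. -/
lemma second_deriv_le_of_eventually_le {h h' W W' : ℝ → ℝ} {d w : ℝ}
    (hh : ∀ᶠ s in 𝓝 (0 : ℝ), HasDerivAt h (h' s) s) (hh' : HasDerivAt h' d 0)
    (hW : ∀ᶠ s in 𝓝 (0 : ℝ), HasDerivAt W (W' s) s) (hW' : HasDerivAt W' w 0)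
    (h0 : h 0 = W 0) (hle : ∀ᶠ s in 𝓝 (0 : ℝ), h s ≤ W s) : d ≤ w := by
  have hmin : IsLocalMin (fun s => W s - h s) 0 := by
    filter_upwards [hle] with s hs
    linarith
  have hd : ∀ᶠ s in 𝓝 (0 : ℝ), HasDerivAt (fun s => W s - h s) (W' s - h' s) s := by
    filter_upwards [hh, hW] with s h1 h2 using h2.sub h1
  have := hmin.second_deriv_nonneg hd (hW'.sub hh')
  linarith

section Lines

variable {m : ℕ}

lemma tendsto_line (x : EuclideanSpace ℝ (Fin m)) (i : Fin m) :
    Tendsto (fun s : ℝ => x + s • EuclideanSpace.single i (1 : ℝ)) (𝓝 0) (𝓝 x) := by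
  have : Continuous fun s : ℝ => x + s • EuclideanSpace.single i (1 : ℝ) := by fun_prop
  simpa using this.tendsto 0

lemma hasDerivAt_line {v : EuclideanSpace ℝ (Fin m) → ℝ} {x : EuclideanSpace ℝ (Fin m)}
    {i : Fin m} {s : ℝ}
    (hv : DifferentiableAt ℝ v (x + s • EuclideanSpace.single i (1 : ℝ))) :
    HasDerivAt (fun t : ℝ => v (x + t • EuclideanSpace.single i (1 : ℝ)))
      (pderivE i v (x + s • EuclideanSpace.single i (1 : ℝ))) s := by
  have hl : HasDerivAt (fun t : ℝ => x + t • EuclideanSpace.single i (1 : ℝ))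
      (EuclideanSpace.single i (1 : ℝ)) s := by
    simpa using ((hasDerivAt_id s).smul_const (EuclideanSpace.single i (1 : ℝ))).const_add x
  exact hv.hasFDerivAt.comp_hasDerivAt s hl

lemma ContDiffAt.eventually_hasDerivAt_line {v : EuclideanSpace ℝ (Fin m) → ℝ}
    {x : EuclideanSpace ℝ (Fin m)} (hv : ContDiffAt ℝ 2 v x) (i : Fin m) :
    ∀ᶠ s in 𝓝 (0 : ℝ), HasDerivAt (fun t : ℝ => v (x + t • EuclideanSpace.single i (1 : ℝ)))
      (pderivE i v (x + s • EuclideanSpace.single i (1 : ℝ))) s := by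
  have h1 : ∀ᶠ y in 𝓝 x, ContDiffAt ℝ 2 v y := hv.eventually (by simp)
  filter_upwards [(tendsto_line x i).eventually h1] with s hs
  exact hasDerivAt_line (hs.differentiableAt (by simp))

lemma ContDiffAt.hasDerivAt_pderivE_line {v : EuclideanSpace ℝ (Fin m) → ℝ}
    {x : EuclideanSpace ℝ (Fin m)} (hv : ContDiffAt ℝ 2 v x) (i : Fin m) :
    HasDerivAt (fun t : ℝ => pderivE i v (x + t • EuclideanSpace.single i (1 : ℝ)))
      (pderivE i (pderivE i v) x) 0 := by
  have h1 : ContDiffAt ℝ 1 (fderiv ℝ v) x := hv.fderiv_right (by norm_num)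
  have h2 : DifferentiableAt ℝ (pderivE i v) x :=
    (h1.differentiableAt (by simp)).clm_apply (differentiableAt_const _)
  have := hasDerivAt_line (v := pderivE i v) (x := x) (i := i) (s := 0) (by simpa using h2)
  simpa using this

lemma norm_sub_line_sq (x x₀ : EuclideanSpace ℝ (Fin m)) (i : Fin m) (s : ℝ) :
    ‖x + s • EuclideanSpace.single i (1 : ℝ) - x₀‖ ^ 2
      = ‖x - x₀‖ ^ 2 + 2 * (x i - x₀ i) * s + s ^ 2 := by
  rw [show x + s • EuclideanSpace.single i (1 : ℝ) - x₀
    = (x - x₀) + s • EuclideanSpace.single i (1 : ℝ) by abel, norm_add_sq_real]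
  simp [inner_smul_right, EuclideanSpace.inner_single_right, norm_smul]
  ring

end Lines

section Barrier

variable {α M T p a : ℝ}

lemma hasDerivAt_barrier {s : ℝ} (hs : 0 < p - 2 * a * s - s ^ 2) :
    HasDerivAt (fun t : ℝ => T + M * (p - 2 * a * t - t ^ 2) ^ (-α))
      (M * α * (2 * a + 2 * s) * (p - 2 * a * s - s ^ 2) ^ (-α - 1)) s := by
  have h1 : HasDerivAt (fun t : ℝ => p - 2 * a * t - t ^ 2) (-(2 * a) - 2 * s) s := by
    simpa using (((hasDerivAt_id s).const_mul (2 * a)).const_sub p).fun_sub (hasDerivAt_pow 2 s)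
  refine (((h1.rpow_const (p := -α) (Or.inl hs.ne')).const_mul M).const_add T).congr_deriv ?_
  ring

lemma eventually_hasDerivAt_barrier (hp : 0 < p) :
    ∀ᶠ s in 𝓝 (0 : ℝ), HasDerivAt (fun t : ℝ => T + M * (p - 2 * a * t - t ^ 2) ^ (-α))
      (M * α * (2 * a + 2 * s) * (p - 2 * a * s - s ^ 2) ^ (-α - 1)) s := by
  have hc : Continuous fun s : ℝ => p - 2 * a * s - s ^ 2 := by fun_prop
  filter_upwards [hc.continuousAt.eventually (lt_mem_nhds (a := 0) (by simpa using hp))]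
    with s hs using hasDerivAt_barrier hs

lemma hasDerivAt_deriv_barrier (hp : 0 < p) :
    HasDerivAt (fun s : ℝ => M * α * (2 * a + 2 * s) * (p - 2 * a * s - s ^ 2) ^ (-α - 1))
      (M * α * (2 * p ^ (-α - 1) + 4 * (α + 1) * a ^ 2 * p ^ (-α - 2))) 0 := by
  have h1 : HasDerivAt (fun t : ℝ => p - 2 * a * t - t ^ 2) (-(2 * a) - 2 * 0) 0 := by
    simpa using (((hasDerivAt_id (0 : ℝ)).const_mul (2 * a)).const_sub p).fun_sub
      (hasDerivAt_pow 2 (0 : ℝ))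
  have h2 : HasDerivAt (fun t : ℝ => M * α * (2 * a + 2 * t)) (M * α * 2) 0 := by
    simpa using (((hasDerivAt_id (0 : ℝ)).const_mul 2).const_add (2 * a)).const_mul (M * α)
  refine (h2.fun_mul
    (h1.rpow_const (p := -α - 1) (Or.inl (by simpa using hp.ne')))).congr_deriv ?_
  simp only [mul_zero, sub_zero, add_zero, ne_eq, OfNat.ofNat_ne_zero, not_false_eq_true, zero_pow]
  rw [show -α - 1 - 1 = -α - 2 by ring]
  ring

end Barrier

/-- **Keller–Osserman estimate** at the centre of a ball meeting a halfspace: a subsolution of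
`Δu = β c u ^ σ` above the level `T`, with nonnegative inward derivative on the flat boundary part,
is controlled by the radius of the ball. -/
lemma keller_osserman_halfspace {m : ℕ} (j : Fin m) {u b : EuclideanSpace ℝ (Fin m) → ℝ}
    {f : ℝ → ℝ} {σ c T β A R α : ℝ} {x₀ : EuclideanSpace ℝ (Fin m)}
    (hσ : 1 < σ) (hα : α * (σ - 1) = 2) (hc : 0 < c) (hT : 0 ≤ T) (hβ : 0 < β) (hR : 0 < R)
    (hA : 0 < A) (hAR : α * R ^ 2 * (2 * m + 4 * (α + 1)) ≤ β * c * A ^ (σ - 1))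
    (hx₀ : 0 < x₀ j)
    (hf : ∀ t, T < t → c * t ^ σ ≤ f t)
    (hb : ∀ x ∈ Metric.closedBall x₀ R, 0 ≤ x j → β ≤ b x)
    (hu : ∀ x, 0 ≤ x j → ContDiffAt ℝ 2 u x)
    (hbdy : ∀ x, x j = 0 → 0 ≤ pderivE j u x)
    (hineq : ∀ x, 0 ≤ x j → T < u x → b x * f (u x) ≤ laplacianE u x) :
    (u x₀ - T) * (R ^ 2) ^ α ≤ A := by
  have hα0 : 0 < α := by
    by_contra! h
    nlinarith
  by_contra! hcon
  let ψ : EuclideanSpace ℝ (Fin m) → ℝ := fun x => R ^ 2 - ‖x - x₀‖ ^ 2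
  let S : Set (EuclideanSpace ℝ (Fin m)) := Metric.closedBall x₀ R ∩ {x | 0 ≤ x j}
  have hψc : Continuous ψ := by fun_prop
  have hcoord : Continuous fun x : EuclideanSpace ℝ (Fin m) => x j := by fun_prop
  have hS : IsCompact S :=
    (isCompact_closedBall x₀ R).inter_right (isClosed_le continuous_const hcoord)
  have hx₀S : x₀ ∈ S := ⟨Metric.mem_closedBall_self hR.le, hx₀.le⟩
  have hucont : ContinuousOn u S := fun x hx => (hu x hx.2).continuousAt.continuousWithinAt
  have hFc : ContinuousOn (fun x => (u x - T) * ψ x ^ α) S :=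
    (hucont.sub continuousOn_const).mul
      (hψc.rpow_const fun _ => Or.inr hα0.le).continuousOn
  obtain ⟨x, hxS, hxmax⟩ := hS.exists_isMaxOn ⟨x₀, hx₀S⟩ hFc
  obtain ⟨M, hM⟩ : ∃ M, M = (u x - T) * ψ x ^ α := ⟨_, rfl⟩
  have hmax : ∀ y ∈ S, (u y - T) * ψ y ^ α ≤ M := fun y hy => by
    rw [hM]; exact hxmax hy
  have hAM : A < M := by
    refine hcon.trans_le ?_
    simpa [ψ] using hmax x₀ hx₀S
  have hM0 : 0 < M := hA.trans hAM
  have hp : 0 < ψ x := by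
    have h1 : 0 ≤ ψ x := by
      have := hxS.1
      rw [mem_closedBall_iff_norm] at this
      have := pow_le_pow_left₀ (norm_nonneg _) this 2
      simp only [ψ]; linarith
    refine h1.lt_of_ne fun h => ?_
    rw [← h, Real.zero_rpow hα0.ne', mul_zero] at hM
    exact hM0.ne' hM
  have hle : ∀ y, 0 < ψ y → 0 ≤ y j → u y ≤ T + M * ψ y ^ (-α) := by
    intro y hy hyj
    have hyS : y ∈ S := by
      refine ⟨?_, hyj⟩
      rw [mem_closedBall_iff_norm]
      refine le_of_sq_le_sq ?_ hR.le
      simp only [ψ] at hy; linarith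
    have h := hmax y hyS
    have hpos : 0 < ψ y ^ α := Real.rpow_pos_of_pos hy α
    rw [Real.rpow_neg hy.le, ← div_eq_mul_inv]
    have := (le_div_iff₀ hpos).2 h
    linarith
  have hux : u x = T + M * ψ x ^ (-α) := by
    have hpos : 0 < ψ x ^ α := Real.rpow_pos_of_pos hp α
    rw [Real.rpow_neg hp.le, hM]
    field_simp
    ring
  obtain ⟨p, hpdef⟩ : ∃ p, p = ψ x := ⟨_, rfl⟩
  rw [← hpdef] at hp hux
  have hline : ∀ i s, ψ (x + s • EuclideanSpace.single i (1 : ℝ))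
      = p - 2 * (x i - x₀ i) * s - s ^ 2 := by
    intro i s
    simp only [hpdef, ψ, norm_sub_line_sq]
    ring
  have hψpos : ∀ i, ∀ᶠ s in 𝓝 (0 : ℝ), 0 < ψ (x + s • EuclideanSpace.single i (1 : ℝ)) :=
    fun i => (tendsto_line x i).eventually
      (hψc.continuousAt.eventually (lt_mem_nhds (hpdef ▸ hp)))
  rcases (show 0 ≤ x j from hxS.2).eq_or_lt with hxj | hxj
  · have hd := (hu x hxS.2).eventually_hasDerivAt_line j |>.self_of_nhds
    have hW := (eventually_hasDerivAt_barrier (α := α) (M := M) (T := T) (a := x j - x₀ j)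
      hp).self_of_nhds
    have := hd.le_of_eventually_le_right hW (by simpa using hux) (by
      filter_upwards [nhdsWithin_le_nhds (hψpos j), self_mem_nhdsWithin] with s hs hspos
      have hspos' : (0 : ℝ) < s := hspos
      rw [← hline]
      exact hle _ hs (by simp [← hxj, hspos'.le]))
    have hb0 := hbdy x hxj.symm
    have hneg : M * α * (2 * (x j - x₀ j)) * p ^ (-α - 1) < 0 := by
      have : 0 < p ^ (-α - 1) := Real.rpow_pos_of_pos hp _
      have : 0 < M * α * p ^ (-α - 1) * x₀ j := by positivity
      rw [← hxj]; nlinarith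
    simp at this
    linarith
  · have hsecond : ∀ i, pderivE i (pderivE i u) x
        ≤ M * α * (2 * p ^ (-α - 1) + 4 * (α + 1) * (x i - x₀ i) ^ 2 * p ^ (-α - 2)) := by
      intro i
      refine second_deriv_le_of_eventually_le ((hu x hxS.2).eventually_hasDerivAt_line i)
        ((hu x hxS.2).hasDerivAt_pderivE_line i)
        (eventually_hasDerivAt_barrier (α := α) (M := M) (T := T) (a := x i - x₀ i) hp)
        (hasDerivAt_deriv_barrier hp) (by simpa using hux) ?_
      filter_upwards [hψpos i, (tendsto_line x i).eventually
        (hcoord.continuousAt.eventually (lt_mem_nhds hxj))] with s hs hsj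
      rw [← hline]
      exact hle _ hs hsj.le
    have hpow : p ^ (-α - 1) = p * p ^ (-α - 2) := by
      rw [← Real.rpow_one_add' hp.le (by linarith)]
      ring_nf
    obtain ⟨P, hP⟩ : ∃ P, P = p ^ (-α - 2) := ⟨_, rfl⟩
    have hP0 : 0 < P := hP ▸ Real.rpow_pos_of_pos hp _
    have hsum : laplacianE u x ≤ M * α * (2 * m * p + 4 * (α + 1) * ‖x - x₀‖ ^ 2) * P := by
      refine (Finset.sum_le_sum fun i _ => hsecond i).trans_eq ?_
      rw [hpow, ← hP, EuclideanSpace.real_norm_sq_eq]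
      simp only [PiLp.sub_apply, ← Finset.mul_sum, Finset.sum_add_distrib, ← Finset.sum_mul,
        Finset.sum_const, Finset.card_univ, Fintype.card_fin, nsmul_eq_mul]
      ring
    have hpR : p ≤ R ^ 2 := by
      simp only [hpdef, ψ]; linarith [sq_nonneg ‖x - x₀‖]
    have hrR : ‖x - x₀‖ ^ 2 ≤ R ^ 2 := by
      have : p = R ^ 2 - ‖x - x₀‖ ^ 2 := hpdef
      linarith
    have hupper : laplacianE u x ≤ M * P * (β * c * A ^ (σ - 1)) := by
      calc laplacianE u x ≤ M * α * (2 * m * p + 4 * (α + 1) * ‖x - x₀‖ ^ 2) * P := hsum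
        _ ≤ M * α * (2 * m * R ^ 2 + 4 * (α + 1) * R ^ 2) * P := by gcongr
        _ = M * P * (α * R ^ 2 * (2 * m + 4 * (α + 1))) := by ring
        _ ≤ _ := by gcongr
    have hMp : 0 < M * p ^ (-α) := by
      have := Real.rpow_pos_of_pos hp (-α)
      positivity
    have huT : T < u x := by rw [hux]; linarith
    have hlower : β * (c * (M ^ (σ - 1) * M * P)) ≤ laplacianE u x := by
      have hPσ : (M * p ^ (-α)) ^ σ = M ^ (σ - 1) * M * P := by
        rw [Real.mul_rpow hM0.le (Real.rpow_nonneg hp.le _), ← Real.rpow_mul hp.le, hP,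
          ← Real.rpow_add_one hM0.ne']
        congr 2 <;> linarith
      have h1 : c * (M ^ (σ - 1) * M * P) ≤ f (u x) := by
        refine le_trans ?_ (hf _ huT)
        rw [← hPσ]
        gcongr
        linarith
      refine le_trans ?_ (hineq x hxS.2 huT)
      have hβb := hb x hxS.1 hxS.2
      have : 0 ≤ c * (M ^ (σ - 1) * M * P) := by positivity
      exact mul_le_mul hβb h1 this (hβ.le.trans hβb)
    have hlt : A ^ (σ - 1) < M ^ (σ - 1) := Real.rpow_lt_rpow hA.le hAM (by linarith)
    have : M * P * (β * c * A ^ (σ - 1)) < β * (c * (M ^ (σ - 1) * M * P)) := by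
      calc _ < M * P * (β * c * M ^ (σ - 1)) := by gcongr
        _ = _ := by ring
    linarith

/-- Instance on the closed upper halfspace `H = {x ∈ ℝ^m : x_m ≥ 0}`, with classical `C²`
regularity, of the a priori boundedness **Theorem 3.8** of the paper.  `Q : [0,∞) → (0,∞)` is
nondecreasing with `Q(t) = o(t²)` and `liminf Q(t)·log t/t² < ∞`; `b` is continuous and
positive on `H` with `b(x) ≥ 1/Q(|x|)` outside a compact set; `f` is continuous with
`liminf_{t→∞} f(t)/t^σ > 0` for some `σ > 1`; `u` is `C²` near `H` with `∂u/∂x_m ≥ 0` on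
`∂H`, and `Δu ≥ b·f(u)` on the nonempty superlevel set `Ω_γ = {x ∈ H : u(x) > γ}` (i.e.
`γ < sup_H u ≤ +∞`).  Then `u` is bounded above on `H`. -/
theorem halfspace_apriori_boundedness (m : ℕ) (hm : 2 ≤ m)
    (Q : ℝ → ℝ) (hQpos : ∀ t : ℝ, 0 ≤ t → 0 < Q t) (hQmono : MonotoneOn Q (Set.Ici 0))
    (hlittleo : (fun t => Q t) =o[atTop] fun t => t ^ 2)
    (hliminf : ∃ C : ℝ, ∃ᶠ t in atTop, Q t * Real.log t / t ^ 2 ≤ C)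
    (b : EuclideanSpace ℝ (Fin m) → ℝ)
    (hbc : ContinuousOn b {x : EuclideanSpace ℝ (Fin m) | 0 ≤ x ⟨m - 1, by omega⟩})
    (hbpos : ∀ x : EuclideanSpace ℝ (Fin m), 0 ≤ x ⟨m - 1, by omega⟩ → 0 < b x)
    (K : Set (EuclideanSpace ℝ (Fin m))) (hK : IsCompact K)
    (hbQ : ∀ x : EuclideanSpace ℝ (Fin m), 0 ≤ x ⟨m - 1, by omega⟩ → x ∉ K →
      1 / Q ‖x‖ ≤ b x)
    (f : ℝ → ℝ) (hf : Continuous f) (σ : ℝ) (hσ : 1 < σ)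
    (hfliminf : ∃ c : ℝ, 0 < c ∧ ∀ᶠ t in atTop, c ≤ f t / t ^ σ)
    (u : EuclideanSpace ℝ (Fin m) → ℝ)
    (hu : ∀ x : EuclideanSpace ℝ (Fin m), 0 ≤ x ⟨m - 1, by omega⟩ → ContDiffAt ℝ 2 u x)
    (hbdy : ∀ x : EuclideanSpace ℝ (Fin m), x ⟨m - 1, by omega⟩ = 0 →
      0 ≤ pderivE (⟨m - 1, by omega⟩ : Fin m) u x)
    (γ : ℝ)
    (hγ : ∃ x : EuclideanSpace ℝ (Fin m), 0 ≤ x ⟨m - 1, by omega⟩ ∧ γ < u x)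
    (hineq : ∀ x : EuclideanSpace ℝ (Fin m), 0 ≤ x ⟨m - 1, by omega⟩ → γ < u x →
      b x * f (u x) ≤ laplacianE u x) :
    BddAbove (u '' {x : EuclideanSpace ℝ (Fin m) | 0 ≤ x ⟨m - 1, by omega⟩}) := by
  set j : Fin m := ⟨m - 1, by omega⟩
  obtain ⟨c, hc, hfc⟩ := hfliminf
  obtain ⟨T, hT, hTγ, hfT⟩ : ∃ T : ℝ, 0 ≤ T ∧ γ ≤ T ∧ ∀ t, T < t → c * t ^ σ ≤ f t := by
    obtain ⟨t₀, ht₀⟩ := eventually_atTop.1 hfc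
    refine ⟨max t₀ (max 0 γ), by simp, by simp, fun t ht => ?_⟩
    have ht1 : t₀ < t := (le_max_left _ _).trans_lt ht
    have ht2 : 0 < t := ((le_max_left _ _).trans (le_max_right _ _)).trans_lt ht
    exact (le_div_iff₀ (Real.rpow_pos_of_pos ht2 σ)).1 (ht₀ t ht1.le)
  obtain ⟨ρ, hρ0, hρ⟩ : ∃ ρ : ℝ, 0 < ρ ∧ ∀ x : EuclideanSpace ℝ (Fin m), 0 ≤ x j → ρ < ‖x‖ →
      1 / ‖x‖ ^ 2 ≤ b x := by
    obtain ⟨r, hr⟩ := hK.isBounded.exists_norm_le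
    obtain ⟨t₁, ht₁⟩ := eventually_atTop.1 (hlittleo.bound one_pos)
    refine ⟨max 1 (max r t₁), by simp, fun x hxj hx => ?_⟩
    have h1 : r < ‖x‖ := ((le_max_left _ _).trans (le_max_right _ _)).trans_lt hx
    have h2 : t₁ < ‖x‖ := ((le_max_right _ _).trans (le_max_right _ _)).trans_lt hx
    have hQx := hQpos ‖x‖ (norm_nonneg x)
    have h3 := ht₁ ‖x‖ h2.le
    rw [one_mul, Real.norm_of_nonneg hQx.le, Real.norm_of_nonneg (sq_nonneg _)] at h3
    exact (one_div_le_one_div_of_le hQx h3).trans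
      (hbQ x hxj fun hxK => h1.not_ge (hr x hxK))
  obtain ⟨α, hα⟩ : ∃ α : ℝ, α = 2 / (σ - 1) := ⟨_, rfl⟩
  have hσ1 : 0 < σ - 1 := by linarith
  have hα0 : 0 < α := by rw [hα]; positivity
  have hασ : α * (σ - 1) = 2 := by rw [hα]; field_simp
  obtain ⟨N, hN⟩ : ∃ N : ℝ, N = 9 * (α * (2 * m + 4 * (α + 1))) / c := ⟨_, rfl⟩
  have hN0 : 0 < N := by rw [hN]; positivity
  obtain ⟨D, hD⟩ : ∃ D : ℝ, D = N ^ (σ - 1)⁻¹ := ⟨_, rfl⟩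
  have hD0 : 0 < D := hD ▸ Real.rpow_pos_of_pos hN0 _
  have hinterior : ∀ x : EuclideanSpace ℝ (Fin m), 0 < x j → 2 * ρ < ‖x‖ → u x ≤ T + D := by
    intro x hxj hx
    obtain ⟨R, hR⟩ : ∃ R, R = ‖x‖ / 2 := ⟨_, rfl⟩
    have hR0 : 0 < R := by linarith
    have hpos : 0 < (R ^ 2) ^ α := by positivity
    have key := keller_osserman_halfspace (A := D * (R ^ 2) ^ α) (β := 1 / (9 * R ^ 2)) (b := b)
      (f := f) (x₀ := x) (u := u) j hσ hασ hc hT (by positivity) hR0 (by positivity) ?_ hxj hfT ?_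
      hu hbdy (fun y hyj hy => hineq y hyj (hTγ.trans_lt hy))
    · have := le_of_mul_le_mul_right key hpos
      linarith
    · rw [Real.mul_rpow hD0.le hpos.le, ← Real.rpow_mul (sq_nonneg R), hασ, hD,
        ← Real.rpow_mul hN0.le, inv_mul_cancel₀ hσ1.ne', Real.rpow_one, Real.rpow_two, hN]
      refine le_of_eq ?_
      field_simp
    · intro y hy hyj
      rw [mem_closedBall_iff_norm] at hy
      have h1 : ‖y‖ ≤ 3 * R := by
        have := norm_le_norm_add_norm_sub' y x
        linarith
      have h2 : ρ < ‖y‖ := by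
        have := norm_sub_norm_le x y
        rw [norm_sub_rev] at this
        linarith
      refine le_trans ?_ (hρ y hyj h2)
      refine one_div_le_one_div_of_le (by nlinarith) ?_
      nlinarith [norm_nonneg y]
  have hfar : ∀ x : EuclideanSpace ℝ (Fin m), 0 ≤ x j → 2 * ρ < ‖x‖ → u x ≤ T + D := by
    intro x hxj hx
    have ht := (tendsto_line x j).mono_left (nhdsWithin_le_nhds (s := Set.Ioi 0))
    refine le_of_tendsto ((hu x hxj).continuousAt.tendsto.comp ht) ?_
    filter_upwards [ht.eventually (continuous_norm.continuousAt.eventually (lt_mem_nhds hx)),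
      self_mem_nhdsWithin] with s hs hspos
    have hspos' : (0 : ℝ) < s := hspos
    exact hinterior _ (by simp; linarith) hs
  have hcompact : IsCompact (Metric.closedBall (0 : EuclideanSpace ℝ (Fin m)) (2 * ρ) ∩
      {x | 0 ≤ x j}) :=
    (isCompact_closedBall _ _).inter_right (isClosed_le continuous_const (by fun_prop))
  obtain ⟨B, hB⟩ := hcompact.bddAbove_image (f := u)
    fun x hx => (hu x hx.2).continuousAt.continuousWithinAt
  refine ⟨max B (T + D), ?_⟩
  rintro _ ⟨x, hx, rfl⟩
  rcases le_or_gt ‖x‖ (2 * ρ) with h | h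
  · exact (hB ⟨x, ⟨by simpa using h, hx⟩, rfl⟩).trans (le_max_left _ _)
  · exact (hfar x hx h).trans (le_max_right _ _)
end
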